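/- arXiv:2204.00927 — 3 statements merged into one kernel-verified Lean document; each statement's English description precedes it below -/
import Mathlib

section
/- For every integer l ≥ 2 there exist a λ_l-lacunary sequence N of positive integers, complex coefficients {c_m : m ∈ N(l)} with ∑_{m ∈ N(l)} |c_m|² < ∞, and an increasing sequence Γ_1 ⊂ Γ_2 ⊂ ... of finite subsets of N(l), such that the sums ∑_{m ∈ Γ_n} c_m e^{2πimx} diverge as n → ∞ for almost every x ∈ (0,1). Thus the bound λ_l in the unconditional convergence theorem is critical. -/
open MeasureTheory Filter Finset Topology

noncomputable section

/-- A sequence of positive integers is `lam`-lacunary if `n (k+1) / n k > lam` for all `k`. -/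
def IsLacunary (lam : ℝ) (n : ℕ → ℕ) : Prop :=
  (∀ k, 0 < n k) ∧ ∀ k, lam * (n k : ℝ) < (n (k + 1) : ℝ)

/-- The exponential `e^{2πimx}`. -/
def expi (m : ℤ) (x : ℝ) : ℂ := Complex.exp (2 * Real.pi * Complex.I * m * x)

/-- `N(l)`: integers of the form `ε₁ n_{k₁} + ⋯ + ε_l n_{k_l}` with `ε_j = ±1` and
`k₁ > k₂ > ⋯ > k_l`. -/
def SignedSums (n : ℕ → ℕ) (l : ℕ) : Set ℤ :=
  {m | ∃ (k : Fin l → ℕ) (ε : Fin l → ℤ),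
    StrictAnti k ∧ (∀ j, ε j = 1 ∨ ε j = -1) ∧ m = ∑ j, ε j * (n (k j) : ℤ)}


/-- the basic iteration -/
def gseq (lam : ℝ) (A : ℕ) : ℕ → ℕ
  | 0 => A
  | j + 1 => ⌊lam * (gseq lam A j : ℝ)⌋₊ + 1

lemma gseq_lt (lam : ℝ) (A j : ℕ) : lam * (gseq lam A j : ℝ) < (gseq lam A (j+1) : ℝ) := by
  simp only [gseq]; push_cast; exact Nat.lt_floor_add_one _

lemma gseq_le (lam : ℝ) (h : 1 < lam) (A j : ℕ) :
    (gseq lam A (j+1) : ℝ) ≤ lam * (gseq lam A j : ℝ) + 1 := by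
  simp only [gseq]; push_cast
  have := Nat.floor_le (a := lam * (gseq lam A j : ℝ)) (by positivity)
  linarith

lemma gseq_le_pow (lam : ℝ) (h : 1 < lam) (A j i : ℕ) :
    (gseq lam A (j+i) : ℝ) ≤ lam ^ i * ((gseq lam A j : ℝ) + i) := by
  induction i with
  | zero => simp
  | succ i ih =>
    have h1 := gseq_le lam h A (j+i)
    have h2 : (1:ℝ) ≤ lam ^ (i+1) := one_le_pow₀ h.le
    have h3 : lam * (gseq lam A (j+i) : ℝ) ≤ lam * (lam ^ i * ((gseq lam A j : ℝ) + i)) := by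
      gcongr
    rw [← add_assoc]; push_cast
    have : lam ^ (i+1) * ((gseq lam A j : ℝ) + (i + 1)) =
      lam * (lam ^ i * ((gseq lam A j : ℝ) + i)) + lam ^ (i+1) := by ring
    linarith

lemma gseq_sum (lam : ℝ) (h : 1 < lam) (r : ℕ)
    (heq : lam ^ (r+1) = ∑ i ∈ range (r+1), lam ^ i) (A : ℕ) :
    lam * (gseq lam A r : ℝ) ≤ ∑ j ∈ range (r+1), (gseq lam A j : ℝ) + (r+1)*r := by
  have hp : 0 < lam ^ r := by positivity
  have key : ∀ i ∈ range (r+1), lam ^ i * (gseq lam A r : ℝ)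
      ≤ lam ^ r * ((gseq lam A i : ℝ) + r) := by
    intro i hi
    have hi' : i ≤ r := by simpa [Nat.lt_succ_iff] using hi
    obtain ⟨t, rfl⟩ := Nat.exists_eq_add_of_le hi'
    have := gseq_le_pow lam h A i t
    calc lam ^ i * (gseq lam A (i+t) : ℝ) ≤ lam ^ i * (lam ^ t * ((gseq lam A i : ℝ) + t)) := by
          gcongr
      _ = lam ^ (i+t) * ((gseq lam A i : ℝ) + t) := by rw [pow_add]; ring
      _ ≤ _ := by gcongr; linarith [(Nat.cast_nonneg i : (0:ℝ) ≤ i)]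
  have := Finset.sum_le_sum key
  rw [← Finset.sum_mul, ← heq, ← Finset.mul_sum, Finset.sum_add_distrib] at this
  simp only [sum_const, card_range, nsmul_eq_mul] at this
  have h2 : lam ^ r * (lam * (gseq lam A r : ℝ)) ≤
      lam ^ r * (∑ j ∈ range (r+1), (gseq lam A j : ℝ) + (r+1)*r) := by
    rw [pow_succ] at this; push_cast at this; linarith
  exact le_of_mul_le_mul_left h2 hp

/-- block of length `r+2` -/
def blk (lam : ℝ) (r A d j : ℕ) : ℕ :=
  if j ≤ r then gseq lam A j else ∑ i ∈ range (r+1), gseq lam A i + d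

def Aseq (lam : ℝ) (r D : ℕ) : ℕ → ℕ
  | 0 => 1
  | q + 1 => ⌊lam * (blk lam r (Aseq lam r D q) (D + q) (r+1) : ℝ)⌋₊ + 1

def nseq (lam : ℝ) (r D k : ℕ) : ℕ :=
  blk lam r (Aseq lam r D (k / (r+2))) (D + k / (r+2)) (k % (r+2))

lemma gseq_pos (lam : ℝ) (A j : ℕ) (hA : 0 < A) : 0 < gseq lam A j := by
  cases j <;> simp [gseq, hA]

lemma Aseq_pos (lam : ℝ) (r D q : ℕ) : 0 < Aseq lam r D q := by
  cases q <;> simp [Aseq]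

lemma exists_seq (lam : ℝ) (h : 1 < lam) (r : ℕ)
    (heq : lam ^ (r+1) = ∑ i ∈ range (r+1), lam ^ i) :
    ∃ n : ℕ → ℕ, IsLacunary lam n ∧ ∃ D : ℤ, ∀ m : ℤ, D ≤ m → m ∈ SignedSums n (r+2) := by
  set D : ℕ := (r+1)*r + 1 with hD
  refine ⟨nseq lam r D, ⟨?_, ?_⟩, D, ?_⟩
  · intro k
    unfold nseq blk
    split_ifs
    · exact gseq_pos _ _ _ (Aseq_pos _ _ _ _)
    · exact Nat.add_pos_right _ (Nat.add_pos_left (by omega) _)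
  · intro k
    have hlt := Nat.mod_lt k (show 0 < r + 2 by omega)
    have hk := Nat.div_add_mod k (r+2)
    set q := k / (r+2) with hq
    set t := k % (r+2) with ht
    by_cases h1 : t = r+1
    · have e : k + 1 = (r+2) * (q+1) := by rw [← hk, h1]; ring
      have e1 : (k+1) / (r+2) = q+1 := by rw [e]; exact Nat.mul_div_cancel_left _ (by omega)
      have e2 : (k+1) % (r+2) = 0 := by rw [e]; exact Nat.mul_mod_right _ _
      unfold nseq
      rw [e1, e2, ← hq, ← ht, h1]
      rw [show blk lam r (Aseq lam r D (q+1)) (D + (q+1)) 0 = Aseq lam r D (q+1) by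
        simp [blk, gseq]]
      simp only [Aseq]; push_cast; exact Nat.lt_floor_add_one _
    · have e : k + 1 = (t+1) + (r+2) * q := by omega
      have e1 : (k+1) / (r+2) = q := by
        rw [e, Nat.add_mul_div_left _ _ (by omega), Nat.div_eq_of_lt (by omega)]; simp
      have e2 : (k+1) % (r+2) = t+1 := by
        rw [e, Nat.add_mul_mod_self_left, Nat.mod_eq_of_lt (by omega)]
      unfold nseq
      rw [e1, e2, ← hq, ← ht]
      by_cases h2 : t = r
      · have := gseq_sum lam h r heq (Aseq lam r D q)
        rw [h2]
        simp only [blk, le_refl, if_true, Nat.not_succ_le_self, if_false]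
        push_cast
        rw [hD]; push_cast
        have : (0:ℝ) ≤ q := Nat.cast_nonneg q
        linarith
      · have : t + 1 ≤ r := by omega
        have h3 : t ≤ r := by omega
        simp only [blk, this, h3, if_true]
        exact gseq_lt _ _ _
  · intro m hm
    obtain ⟨q, hq⟩ : ∃ q : ℕ, m = (D : ℤ) + q := ⟨(m - D).toNat, by omega⟩
    refine ⟨fun j => (r+2) * q + (r + 1 - j), fun j => if j = 0 then 1 else -1, ?_, ?_, ?_⟩
    · intro i j hij
      have : (i:ℕ) < j := hij
      have := j.2
      show (r+2) * q + (r + 1 - (j:ℕ)) < (r+2) * q + (r + 1 - (i:ℕ))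
      omega
    · intro j; dsimp only; split_ifs <;> simp
    · have hn : ∀ t, t < r+2 → nseq lam r D ((r+2)*q + t) = blk lam r (Aseq lam r D q) (D+q) t := by
        intro t ht
        have e1 : ((r+2)*q + t) / (r+2) = q := by
          rw [Nat.mul_add_div (by omega), Nat.div_eq_of_lt ht]; simp
        have e2 : ((r+2)*q + t) % (r+2) = t := by
          rw [Nat.mul_add_mod, Nat.mod_eq_of_lt ht]
        unfold nseq; rw [e1, e2]
      rw [Fin.sum_univ_succ]
      simp only [Fin.val_zero, Fin.succ_ne_zero, if_true, if_false, Fin.val_succ]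
      rw [hn _ (by omega)]
      have : ∀ i : Fin (r+1), (-1 : ℤ) * (nseq lam r D ((r+2)*q + (r+1-(i+1))) : ℤ) =
        - (gseq lam (Aseq lam r D q) (r + 1 - 1 - i) : ℤ) := by
        intro i
        rw [hn _ (by omega)]
        simp [blk]
      rw [Finset.sum_congr rfl (fun i _ => this i),
        Fin.sum_univ_eq_sum_range (fun i => - (gseq lam (Aseq lam r D q) (r + 1 - 1 - i) : ℤ)),
        Finset.sum_range_reflect (fun i => - (gseq lam (Aseq lam r D q) i : ℤ))]
      simp [blk, hq]

/-- Haar probability measure on the circle. -/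
abbrev mu0 : Measure UnitAddCircle := AddCircle.haarAddCircle

/-- value of the trigonometric polynomial given by a list -/
def LS (L : List (ℤ × ℂ)) (x : UnitAddCircle) : ℂ := (L.map fun p => p.2 * fourier p.1 x).sum

/-- energy of the list -/
def LEn (L : List (ℤ × ℂ)) : ℝ := (L.map fun p => ‖p.2‖ ^ 2).sum

lemma LS_append (L₁ L₂ : List (ℤ × ℂ)) (x) : LS (L₁ ++ L₂) x = LS L₁ x + LS L₂ x := by
  simp [LS]

lemma LEn_append (L₁ L₂ : List (ℤ × ℂ)) : LEn (L₁ ++ L₂) = LEn L₁ + LEn L₂ := by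
  simp [LEn]

lemma LS_measurable (L : List (ℤ × ℂ)) : Measurable (LS L) := by
  induction L with
  | nil => exact measurable_const (a := (0:ℂ))
  | cons p L ih =>
    have : LS (p :: L) = fun x => p.2 * fourier p.1 x + LS L x := by ext x; simp [LS]
    rw [this]
    exact (((fourier p.1).continuous.measurable).const_mul p.2).add ih

lemma setIntegral_poly (E : Set UnitAddCircle) (M : ℤ) :
    mu0.real E / 8 + (∫ x in E, (fourier M x : ℂ) ∂mu0).re * (3/8)
      + (∫ x in E, (fourier (2*M) x : ℂ) ∂mu0).re / 4
      ≤ mu0.real (E ∩ {x | 1/4 < (fourier M x : ℂ).re}) := by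
  have hItg : ∀ n : ℤ, Integrable (fun x => (fourier n x : ℂ)) (mu0.restrict E) := fun n =>
    ((fourier n).continuous.integrable_of_hasCompactSupport
      (HasCompactSupport.of_compactSpace _)).restrict
  have hre : ∀ n : ℤ, (∫ x in E, (fourier n x : ℂ) ∂mu0).re = ∫ x in E, (fourier n x : ℂ).re ∂mu0 :=
    fun n => (integral_re (hItg n)).symm
  have hItg' : ∀ n : ℤ, Integrable (fun x => (fourier n x : ℂ).re) (mu0.restrict E) :=
    fun n => (hItg n).re
  have hm : MeasurableSet {x : UnitAddCircle | 1/4 < (fourier M x : ℂ).re} :=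
    measurableSet_lt measurable_const (Complex.measurable_re.comp (fourier M).continuous.measurable)
  have hl : mu0.real E / 8 + (∫ x in E, (fourier M x : ℂ) ∂mu0).re * (3/8)
      + (∫ x in E, (fourier (2*M) x : ℂ) ∂mu0).re / 4 =
      ∫ x in E, (1/8 + (fourier M x : ℂ).re * (3/8) + (fourier (2*M) x : ℂ).re / 4) ∂mu0 := by
    rw [integral_add, integral_add, hre, hre, integral_mul_const, integral_const, integral_div,
      measureReal_restrict_apply_univ, smul_eq_mul]
    · ring
    · exact integrable_const _
    · exact (hItg' _).mul_const _
    · exact (integrable_const _).add ((hItg' _).mul_const _)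
    · exact (hItg' _).div_const _
  have hr : mu0.real (E ∩ {x | 1/4 < (fourier M x : ℂ).re}) =
      ∫ x in E, ({x : UnitAddCircle | 1/4 < (fourier M x : ℂ).re}.indicator (fun _ => (1:ℝ)) x)
        ∂mu0 := by
    rw [integral_indicator hm, Measure.restrict_restrict hm, Set.inter_comm]
    simp
  rw [hl, hr]
  apply integral_mono
  · exact ((integrable_const _).add ((hItg' _).mul_const _)).add ((hItg' _).div_const _)
  · exact (integrable_const _).indicator hm
  · intro x
    have h2 : (fourier (2*M) x : ℂ) = fourier M x * fourier M x := by
      rw [two_mul, fourier_add]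
    have hn : ‖(fourier M x : ℂ)‖ = 1 := by rw [fourier_apply]; exact Circle.norm_coe _
    have hn2 : (fourier M x : ℂ).re ^ 2 + (fourier M x : ℂ).im ^ 2 = 1 := by
      have := Complex.sq_norm (fourier M x : ℂ)
      rw [hn, Complex.normSq_apply] at this; linarith
    dsimp only
    rw [h2, Complex.mul_re]
    set u := (fourier M x : ℂ).re
    set v := (fourier M x : ℂ).im
    have hu : -1 ≤ u ∧ u ≤ 1 := by constructor <;> nlinarith [sq_nonneg v]
    by_cases h : x ∈ {x : UnitAddCircle | 1/4 < (fourier M x : ℂ).re}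
    · rw [Set.indicator_of_mem h]; nlinarith
    · rw [Set.indicator_of_notMem h]
      have : u ≤ 1/4 := not_lt.mp h
      nlinarith

lemma fourierCoeff_ind (E : Set UnitAddCircle) (hE : MeasurableSet E) (n : ℤ) :
    fourierCoeff (indicatorConstLp 2 hE (measure_ne_top mu0 E) (1:ℂ) : UnitAddCircle → ℂ) n
      = ∫ x in E, (fourier (-n) x : ℂ) ∂mu0 := by
  rw [fourierCoeff, ← integral_indicator hE]
  apply integral_congr_ae
  filter_upwards [indicatorConstLp_coeFn (p := 2) (hs := hE) (hμs := measure_ne_top mu0 E)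
    (c := (1:ℂ))] with x hx
  rw [hx]
  by_cases h : x ∈ E <;> simp [h]

lemma exists_mid (E : Set UnitAddCircle) (hE : MeasurableSet E) (δ : ℝ) (hδ : 0 < δ) (B : ℤ) :
    ∃ (L : List (ℤ × ℂ)) (M : ℤ), (∀ p ∈ L, B < p.1) ∧ (L.map Prod.fst).Nodup ∧
      LEn L ≤ mu0.real E ∧
      mu0.real E / 8 - δ ≤ mu0.real (E ∩ {x | 1/4 < (fourier M x : ℂ).re}) ∧
      mu0.real {x | δ ≤ ‖LS L x - E.indicator (fun _ => (1:ℂ)) x * fourier M x‖} ≤ δ := by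
  set f := indicatorConstLp 2 hE (measure_ne_top mu0 E) (1:ℂ) with hf
  have hfae := indicatorConstLp_coeFn (p := 2) (hs := hE) (hμs := measure_ne_top mu0 E)
    (c := (1:ℂ))
  rw [← hf] at hfae
  have hsum := hasSum_fourier_series_L2 f
  have hsq := hasSum_sq_fourierCoeff f
  have hEint : ∫ t : UnitAddCircle, ‖f t‖ ^ 2 ∂mu0 = mu0.real E := by
    have : ∫ t : UnitAddCircle, ‖f t‖ ^ 2 ∂mu0 = ∫ t, E.indicator (fun _ => (1:ℝ)) t ∂mu0 := by
      apply integral_congr_ae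
      filter_upwards [hfae] with x hx
      rw [hx]
      by_cases h : x ∈ E <;> simp [h]
    rw [this, integral_indicator hE]; simp
  rw [hEint] at hsq
  -- finite set
  have hmeas := tendstoInMeasure_of_tendsto_Lp hsum
  rw [tendstoInMeasure_iff_measureReal_norm] at hmeas
  obtain ⟨F, hF⟩ := ((hmeas δ hδ).eventually (gt_mem_nhds hδ)).exists
  have hFae : ∀ᵐ x ∂mu0, (↑(∑ i ∈ F, fourierCoeff f i • fourierLp 2 i :
      Lp ℂ 2 mu0) : UnitAddCircle → ℂ) x = ∑ i ∈ F, fourierCoeff f i * fourier i x := by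
    have h1 : ∀ i : ℤ, ∀ᵐ x ∂mu0, (↑(fourierCoeff f i • fourierLp 2 i : Lp ℂ 2 mu0) :
        UnitAddCircle → ℂ) x = fourierCoeff f i * fourier i x := by
      intro i
      filter_upwards [Lp.coeFn_smul (fourierCoeff f i) (fourierLp 2 i : Lp ℂ 2 mu0),
        coeFn_fourierLp (T := 1) 2 i] with x h1 h2
      rw [h1, Pi.smul_apply, h2, smul_eq_mul]
    filter_upwards [Lp.coeFn_finsetSum F (fun i => (fourierCoeff f i • fourierLp 2 i : Lp ℂ 2 mu0)),
      ae_all_iff.mpr h1] with x h2 h3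
    rw [h2, Finset.sum_apply]
    exact Finset.sum_congr rfl fun i _ => h3 i
  -- choice of M
  have htend : Tendsto (fun n : ℤ => ‖fourierCoeff f n‖ ^ 2) cofinite (𝓝 0) :=
    hsq.summable.tendsto_cofinite_zero
  have hcof : ∀ᶠ n : ℤ in cofinite, ‖fourierCoeff f n‖ ^ 2 < δ ^ 2 :=
    htend.eventually (gt_mem_nhds (by positivity))
  have hbot : ∀ᶠ n : ℤ in atBot, ‖fourierCoeff f n‖ ^ 2 < δ ^ 2 :=
    hcof.filter_mono atBot_le_cofinite
  have htop1 : ∀ᶠ M : ℤ in atTop, ‖fourierCoeff f (-M)‖ ^ 2 < δ ^ 2 :=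
    tendsto_neg_atTop_atBot.eventually hbot
  have htop2 : ∀ᶠ M : ℤ in atTop, ‖fourierCoeff f (-(2*M))‖ ^ 2 < δ ^ 2 :=
    (tendsto_neg_atTop_atBot.comp
      (tendsto_id.const_mul_atTop' (show (0:ℤ) < 2 by norm_num))).eventually hbot
  have hlow : ∀ᶠ M : ℤ in atTop, ∀ m ∈ F, B < m + M := by
    rw [Filter.eventually_all_finset]
    intro m _
    filter_upwards [eventually_gt_atTop (B - m)] with M hM
    omega
  obtain ⟨M, hM1, hM2, hM3⟩ := (htop1.and (htop2.and hlow)).exists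
  refine ⟨F.toList.map fun m => (m + M, fourierCoeff f m), M, ?_, ?_, ?_, ?_, ?_⟩
  · intro p hp
    simp only [List.mem_map, Finset.mem_toList] at hp
    obtain ⟨m, hm, rfl⟩ := hp
    exact hM3 m hm
  · rw [List.map_map]
    refine List.Nodup.map ?_ F.nodup_toList
    intro a b h
    simpa using h
  · have : LEn (F.toList.map fun m => (m + M, fourierCoeff f m)) = ∑ m ∈ F, ‖fourierCoeff f m‖ ^ 2 := by
      rw [LEn, List.map_map, ← Finset.sum_map_toList]; rfl
    rw [this]
    exact sum_le_hasSum F (fun i _ => by positivity) hsq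
  · have h := setIntegral_poly E M
    have e1 := fourierCoeff_ind E hE (-M)
    have e2 := fourierCoeff_ind E hE (-(2*M))
    rw [neg_neg, ← hf] at e1 e2
    rw [← e1, ← e2] at h
    have b1 := abs_le.mp (Complex.abs_re_le_norm (fourierCoeff f (-M)))
    have b2 := abs_le.mp (Complex.abs_re_le_norm (fourierCoeff f (-(2*M))))
    have c1 := lt_of_pow_lt_pow_left₀ 2 hδ.le hM1
    have c2 := lt_of_pow_lt_pow_left₀ 2 hδ.le hM2
    linarith
  · refine le_trans (le_of_eq ?_) hF.le
    apply measureReal_congr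
    filter_upwards [hFae, hfae] with x h1 h2
    apply propext
    show δ ≤ _ ↔ δ ≤ _
    rw [h1, h2]
    have : LS (F.toList.map fun m => (m + M, fourierCoeff f m)) x =
        (∑ m ∈ F, fourierCoeff f m * fourier m x) * fourier M x := by
      rw [LS, List.map_map, Finset.sum_mul, ← Finset.sum_map_toList]
      congr 1
      apply List.map_congr_left
      intro m _
      simp only [Function.comp, fourier_add]; ring
    rw [this, ← sub_mul, norm_mul]
    have hn : ‖(fourier M x : ℂ)‖ = 1 := by rw [fourier_apply]; exact Circle.norm_coe _
    rw [hn, mul_one]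

/-- the contraction constant -/
def qc : ℝ := 1 - (1 - Real.exp (-(1/8))) / 8

lemma qc_bounds : 0 < qc ∧ qc < 1 := by
  have h1 : Real.exp (-(1/8)) < 1 := by rw [Real.exp_lt_one_iff]; norm_num
  have h2 := Real.exp_pos (-(1/8))
  unfold qc
  constructor <;> linarith

lemma exists_bound (L : List (ℤ × ℂ)) (B : ℤ) : ∃ B' : ℤ, B ≤ B' ∧ ∀ p ∈ L, p.1 ≤ B' := by
  induction L with
  | nil => exact ⟨B, le_rfl, by simp⟩
  | cons a L ih =>
    obtain ⟨B', h0, h⟩ := ih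
    refine ⟨max a.1 B', le_trans h0 (le_max_right _ _), ?_⟩
    intro p hp
    rcases List.mem_cons.mp hp with rfl | hp
    · exact le_max_left _ _
    · exact le_trans (h p hp) (le_max_right _ _)

lemma nodup_app {L₁ L₂ : List (ℤ × ℂ)} (B : ℤ) (h1 : (L₁.map Prod.fst).Nodup)
    (h2 : (L₂.map Prod.fst).Nodup)
    (b1 : ∀ p ∈ L₁, p.1 ≤ B) (b2 : ∀ p ∈ L₂, B < p.1) : ((L₁ ++ L₂).map Prod.fst).Nodup := by
  rw [List.map_append]
  refine List.Nodup.append h1 h2 ?_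
  intro m hm1 hm2
  obtain ⟨p, hp, rfl⟩ := List.mem_map.mp hm1
  obtain ⟨p', hp', he⟩ := List.mem_map.mp hm2
  have := b1 p hp
  have := b2 p' hp'
  omega

lemma nodup_app' {L₁ L₂ : List (ℤ × ℂ)} (B : ℤ) (h1 : (L₁.map Prod.fst).Nodup)
    (h2 : (L₂.map Prod.fst).Nodup)
    (b1 : ∀ p ∈ L₁, B < p.1) (b2 : ∀ p ∈ L₂, p.1 ≤ B) : ((L₁ ++ L₂).map Prod.fst).Nodup := by
  have := nodup_app B h2 h1 b2 b1
  rw [List.map_append] at this ⊢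
  exact List.nodup_append_comm.mp this

lemma integrable_exp_neg (u : UnitAddCircle → ℝ) (hu : Measurable u) (h0 : ∀ x, 0 ≤ u x)
    (E : Set UnitAddCircle) : Integrable (fun x => Real.exp (-u x)) (mu0.restrict E) := by
  refine Integrable.of_bound (C := 1) (hu.neg.exp).aestronglyMeasurable ?_
  filter_upwards with x
  rw [Real.norm_eq_abs, abs_of_pos (Real.exp_pos _), Real.exp_le_one_iff]
  linarith [h0 x]

lemma tree (n : ℕ) : ∀ (E : Set UnitAddCircle), MeasurableSet E → ∀ δ : ℝ, 0 < δ → ∀ B : ℤ,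
    ∃ (L : List (ℤ × ℂ)) (u : UnitAddCircle → ℝ), (∀ p ∈ L, B < p.1) ∧ (L.map Prod.fst).Nodup ∧
      LEn L ≤ n * mu0.real E ∧ Measurable u ∧ (∀ x, 0 ≤ u x) ∧
      (∀ x, ∃ p, p <+: L ∧ u x ≤ (LS p x).re) ∧
      ∫ x in E, Real.exp (-u x) ∂mu0 ≤ qc ^ n * mu0.real E + δ ∧
      mu0.real {x | x ∉ E ∧ δ ≤ ‖LS L x‖} ≤ δ := by
  induction n with
  | zero =>
    intro E hE δ hδ B
    refine ⟨[], fun _ => 0, by simp, by simp, by simp [LEn], measurable_const, by simp, ?_, ?_, ?_⟩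
    · intro x; exact ⟨[], List.prefix_rfl, by simp [LS]⟩
    · simp [hδ.le]
    · have : {x : UnitAddCircle | x ∉ E ∧ δ ≤ ‖LS [] x‖} = ∅ := by
        ext x; simp [LS, hδ]
      rw [this]; simpa using hδ.le
  | succ n ih =>
    intro E hE δ hδ B
    obtain ⟨d, hd, hd1, hd2⟩ : ∃ d : ℝ, 0 < d ∧ 6 * d ≤ δ ∧ d ≤ 1/16 := by
      refine ⟨min (δ/6) (1/16), by positivity, ?_, min_le_right _ _⟩
      have := min_le_left (δ/6) (1/16); linarith
    obtain ⟨Lm, M, hm1, hm2, hm3, hm4, hm5⟩ := exists_mid E hE d hd B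
    obtain ⟨B1, hB1, hB1'⟩ := exists_bound Lm B
    set P : Set UnitAddCircle := {x | 1/4 < (fourier M x : ℂ).re} with hP
    have hPm : MeasurableSet P :=
      measurableSet_lt measurable_const (Complex.measurable_re.comp (fourier M).continuous.measurable)
    have hEp : MeasurableSet (E ∩ P) := hE.inter hPm
    have hEm : MeasurableSet (E \ P) := hE.diff hPm
    obtain ⟨L1, u1, a1, a2, a3, a4, a5, a6, a7, a8⟩ := ih (E \ P) hEm d hd B1
    obtain ⟨B2, hB2, hB2'⟩ := exists_bound L1 B1
    obtain ⟨L2, u2, b1, b2, b3, b4, b5, b6, b7, b8⟩ := ih (E ∩ P) hEp d hd B2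
    set Z1 : Set UnitAddCircle :=
      {x | d ≤ ‖LS Lm x - E.indicator (fun _ => (1:ℂ)) x * fourier M x‖} with hZ1
    set Z2 : Set UnitAddCircle := {x | x ∉ E \ P ∧ d ≤ ‖LS L1 x‖} with hZ2
    set Z3 : Set UnitAddCircle := {x | x ∉ E ∩ P ∧ d ≤ ‖LS L2 x‖} with hZ3
    have hZ1m : MeasurableSet Z1 := by
      refine measurableSet_le measurable_const (Measurable.norm ?_)
      exact (LS_measurable Lm).sub
        ((measurable_const.indicator hE).mul (fourier M).continuous.measurable)
    have hZ2m : MeasurableSet Z2 :=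
      hEm.compl.inter (measurableSet_le measurable_const (LS_measurable L1).norm)
    have hsum : mu0.real (E ∩ P) + mu0.real (E \ P) = mu0.real E :=
      measureReal_inter_add_sdiff hPm
    classical
    set G : Set UnitAddCircle := (E ∩ P) \ (Z1 ∪ Z2) with hG
    have hGm : MeasurableSet G := hEp.diff (hZ1m.union hZ2m)
    set u : UnitAddCircle → ℝ := G.piecewise (fun x => 1/8 + u2 x) u1 with hu
    have hum : Measurable u := Measurable.piecewise hGm (measurable_const.add b4) a4
    have hu0 : ∀ x, 0 ≤ u x := by
      intro x
      by_cases hx : x ∈ G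
      · rw [hu, Set.piecewise_eq_of_mem _ _ _ hx]; linarith [b5 x]
      · rw [hu, Set.piecewise_eq_of_notMem _ _ _ hx]; exact a5 x
    have hmid : ∀ p ∈ L1 ++ Lm, p.1 ≤ B2 := by
      intro p hp
      rcases List.mem_append.mp hp with hp | hp
      · exact hB2' p hp
      · exact le_trans (hB1' p hp) hB2
    refine ⟨(L1 ++ Lm) ++ L2, u, ?_, ?_, ?_, hum, hu0, ?_, ?_, ?_⟩
    · intro p hp
      rcases List.mem_append.mp hp with hp | hp
      · rcases List.mem_append.mp hp with hp | hp
        · exact lt_of_le_of_lt hB1 (a1 p hp)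
        · exact hm1 p hp
      · exact lt_of_le_of_lt (hB1.trans hB2) (b1 p hp)
    · exact nodup_app B2 (nodup_app' B1 a2 hm2 a1 hB1') b2 hmid b1
    · rw [LEn_append, LEn_append]
      push_cast
      have : (n:ℝ) * mu0.real (E \ P) + mu0.real E + n * mu0.real (E ∩ P) =
        (n + 1) * mu0.real E := by rw [← hsum]; ring
      linarith
    · intro x
      by_cases hx : x ∈ G
      · rw [hu, Set.piecewise_eq_of_mem _ _ _ hx]
        obtain ⟨p, hp, hp'⟩ := b6 x
        refine ⟨(L1 ++ Lm) ++ p, (List.prefix_append_right_inj _).mpr hp, ?_⟩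
        obtain ⟨⟨hxE, hxP⟩, hxZ⟩ := hx
        have z1 : ‖LS Lm x - E.indicator (fun _ => (1:ℂ)) x * fourier M x‖ < d := by
          by_contra h; exact hxZ (Or.inl (not_lt.mp h))
        have z2 : ‖LS L1 x‖ < d := by
          by_contra h; exact hxZ (Or.inr ⟨fun h' => h'.2 hxP, not_lt.mp h⟩)
        rw [Set.indicator_of_mem hxE, one_mul] at z1
        have y1 := abs_le.mp ((Complex.abs_re_le_norm _).trans z1.le)
        have y2 := abs_le.mp ((Complex.abs_re_le_norm _).trans z2.le)
        rw [Complex.sub_re] at y1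
        have hxP' : 1/4 < (fourier M x : ℂ).re := hxP
        rw [LS_append, LS_append, Complex.add_re, Complex.add_re]
        linarith [y1.1, y2.1]
      · rw [hu, Set.piecewise_eq_of_notMem _ _ _ hx]
        obtain ⟨p, hp, hp'⟩ := a6 x
        exact ⟨p, hp.trans (by rw [List.append_assoc]; exact List.prefix_append _ _), hp'⟩
    · have hItg := integrable_exp_neg u hum hu0
      have hsplit : ∫ x in E, Real.exp (-u x) ∂mu0 =
          ∫ x in E ∩ P, Real.exp (-u x) ∂mu0 + ∫ x in E \ P, Real.exp (-u x) ∂mu0 :=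
        (integral_inter_add_sdiff hPm (hItg E)).symm
      have hI2 : ∫ x in E \ P, Real.exp (-u x) ∂mu0 = ∫ x in E \ P, Real.exp (-u1 x) ∂mu0 := by
        apply setIntegral_congr_fun hEm
        intro x hx
        have : x ∉ G := fun h => hx.2 h.1.2
        simp only [hu, Set.piecewise_eq_of_notMem _ _ _ this]
      have hZm : MeasurableSet (Z1 ∪ Z2) := hZ1m.union hZ2m
      have hI1 : ∫ x in E ∩ P, Real.exp (-u x) ∂mu0 ≤
          Real.exp (-(1/8)) * ∫ x in E ∩ P, Real.exp (-u2 x) ∂mu0 + mu0.real (Z1 ∪ Z2) := by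
        have i2 := (integrable_exp_neg u2 b4 b5 (E ∩ P)).const_mul (Real.exp (-(1/8)))
        have i3 : Integrable ((Z1 ∪ Z2).indicator (fun _ => (1:ℝ))) (mu0.restrict (E ∩ P)) :=
          (integrable_const _).indicator hZm
        have h3 : ∫ x in E ∩ P, (Z1 ∪ Z2).indicator (fun _ => (1:ℝ)) x ∂mu0
            ≤ mu0.real (Z1 ∪ Z2) := by
          rw [integral_indicator hZm, Measure.restrict_restrict hZm]
          simp only [integral_const, measureReal_restrict_apply_univ, smul_eq_mul, mul_one]
          exact measureReal_mono Set.inter_subset_left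
        have h4 : ∫ x in E ∩ P, Real.exp (-u x) ∂mu0 ≤
            ∫ x in E ∩ P, (Real.exp (-(1/8)) * Real.exp (-u2 x) +
              (Z1 ∪ Z2).indicator (fun _ => (1:ℝ)) x) ∂mu0 := by
          apply setIntegral_mono_on (hItg _) (i2.add i3) hEp
          intro x hx
          rw [Pi.add_apply]
          by_cases hz : x ∈ Z1 ∪ Z2
          · rw [Set.indicator_of_mem hz]
            have e1 : Real.exp (-u x) ≤ 1 := by
              rw [Real.exp_le_one_iff]; linarith [hu0 x]
            have := mul_pos (Real.exp_pos (-(1/8))) (Real.exp_pos (-u2 x))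
            linarith
          · rw [Set.indicator_of_notMem hz, add_zero, ← Real.exp_add]
            have : x ∈ G := ⟨hx, hz⟩
            rw [hu, Set.piecewise_eq_of_mem _ _ _ this]
            apply le_of_eq; congr 1; ring
        rw [integral_add i2 i3, integral_const_mul] at h4
        linarith
      have hZ : mu0.real (Z1 ∪ Z2) ≤ 2 * d := by
        have := measureReal_union_le (μ := mu0) Z1 Z2; linarith
      obtain ⟨q0, q1⟩ := qc_bounds
      have hr0 := Real.exp_pos (-(1/8))
      have hr1 : Real.exp (-(1/8)) < 1 := by rw [Real.exp_lt_one_iff]; norm_num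
      have hqn : 0 < qc ^ n := by positivity
      have hqn1 : qc ^ n ≤ 1 := pow_le_one₀ q0.le q1.le
      have hqdef : qc = 1 - (1 - Real.exp (-(1/8))) / 8 := rfl
      rw [hsplit, hI2, pow_succ]
      set r := Real.exp (-(1/8))
      set a := mu0.real (E ∩ P)
      set b := mu0.real (E \ P)
      set e := mu0.real E
      have s1 : r * ∫ x in E ∩ P, Real.exp (-u2 x) ∂mu0 ≤ r * (qc ^ n * a + d) := by gcongr
      have s2 : r * d ≤ d := by nlinarith
      have s3 : qc ^ n * ((1 - r) * (e / 8 - d)) ≤ qc ^ n * ((1 - r) * a) := by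
        apply mul_le_mul_of_nonneg_left _ hqn.le
        apply mul_le_mul_of_nonneg_left hm4 (by linarith)
      have s4 : qc ^ n * ((1 - r) * d) ≤ d := by
        have : (1 - r) * d ≤ d := by nlinarith
        have h0 : 0 ≤ (1 - r) * d := mul_nonneg (by linarith) hd.le
        nlinarith
      have hb : b = e - a := by linarith
      rw [hb] at a7
      have s5 : qc ^ n * qc * e = qc ^ n * e - qc ^ n * ((1 - r) * (e / 8)) := by
        rw [hqdef]; ring
      rw [s5]
      have s6 : qc ^ n * ((1 - r) * (e / 8 - d)) =
        qc ^ n * ((1 - r) * (e / 8)) - qc ^ n * ((1 - r) * d) := by ring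
      have s7 : r * (qc ^ n * a + d) + qc ^ n * (e - a) =
        qc ^ n * e - qc ^ n * ((1-r) * a) + r * d := by ring
      linarith
    · have hsub : {x | x ∉ E ∧ δ ≤ ‖LS ((L1 ++ Lm) ++ L2) x‖} ⊆ (Z1 ∪ Z2) ∪ Z3 := by
        rintro x ⟨hxE, hx⟩
        by_contra hc
        simp only [Set.mem_union, not_or] at hc
        obtain ⟨⟨c1, c2⟩, c3⟩ := hc
        have z1 : ‖LS Lm x - E.indicator (fun _ => (1:ℂ)) x * fourier M x‖ < d := not_le.mp c1
        have z2 : ‖LS L1 x‖ < d := by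
          by_contra h; exact c2 ⟨fun h' => hxE h'.1, not_lt.mp h⟩
        have z3 : ‖LS L2 x‖ < d := by
          by_contra h; exact c3 ⟨fun h' => hxE h'.1, not_lt.mp h⟩
        rw [Set.indicator_of_notMem hxE, zero_mul, sub_zero] at z1
        rw [LS_append, LS_append] at hx
        have := norm_add₃_le (a := LS L1 x) (b := LS Lm x) (c := LS L2 x)
        linarith
      have h1 := measureReal_mono (μ := mu0) hsub
      have h2 := measureReal_union_le (μ := mu0) (Z1 ∪ Z2) Z3
      have h3 := measureReal_union_le (μ := mu0) Z1 Z2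
      linarith

lemma LS_scale (a : ℝ) (L : List (ℤ × ℂ)) (x : UnitAddCircle) :
    LS (L.map fun p => (p.1, (a:ℂ) * p.2)) x = a * LS L x := by
  induction L with
  | nil => simp [LS]
  | cons p L ih =>
    simp only [LS, List.map_cons, List.sum_cons] at ih ⊢
    rw [ih]; ring

lemma LEn_scale (a : ℝ) (L : List (ℤ × ℂ)) :
    LEn (L.map fun p => (p.1, (a:ℂ) * p.2)) = a ^ 2 * LEn L := by
  induction L with
  | nil => simp [LEn]
  | cons p L ih =>
    simp only [LEn, List.map_cons, List.sum_cons] at ih ⊢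
    rw [ih, norm_mul, mul_pow, Complex.norm_real, Real.norm_eq_abs, sq_abs]; ring

lemma exists_block0 (ε : ℝ) (hε : 0 < ε) (B : ℤ) :
    ∃ (L : List (ℤ × ℂ)) (Z : Set UnitAddCircle), (∀ p ∈ L, B < p.1) ∧
      (L.map Prod.fst).Nodup ∧ LEn L ≤ ε ∧ mu0.real Z ≤ ε ∧
      ∀ x, x ∉ Z → ∃ p, p <+: L ∧ 1 ≤ (LS p x).re := by
  obtain ⟨q0, q1⟩ := qc_bounds
  set s : ℝ := Real.sqrt ε with hs
  have hs0 : 0 < s := Real.sqrt_pos.mpr hε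
  have hs2 : s ^ 2 = ε := Real.sq_sqrt hε.le
  set X : ℝ := Real.exp (1/s) with hX
  have hX0 : 0 < X := Real.exp_pos _
  have t1 : Tendsto (fun k : ℕ => X * qc ^ k) atTop (𝓝 0) := by
    simpa using (tendsto_pow_atTop_nhds_zero_of_lt_one q0.le q1).const_mul X
  have t2 : Tendsto (fun k : ℕ => ((1:ℝ)/2) ^ k) atTop (𝓝 0) :=
    tendsto_pow_atTop_nhds_zero_of_lt_one (by norm_num) (by norm_num)
  obtain ⟨k, hk1, hk2, hk0⟩ := ((t1.eventually (gt_mem_nhds (show (0:ℝ) < 1/2 by norm_num))).and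
    ((t2.eventually (gt_mem_nhds (show (0:ℝ) < ε/2 by positivity))).and
      (eventually_gt_atTop 0))).exists
  have hkr : (0:ℝ) < k := by exact_mod_cast hk0
  have hXk : 0 < X ^ k := by positivity
  obtain ⟨L, u, c1, c2, c3, c4, c5, c6, c7, -⟩ :=
    tree (k ^ 2) Set.univ MeasurableSet.univ (ε / 2 / X ^ k) (by positivity) B
  set a : ℝ := s / k with ha
  have ha0 : 0 < a := by positivity
  refine ⟨L.map fun p => (p.1, (a:ℂ) * p.2), {x | (X ^ k)⁻¹ ≤ Real.exp (-u x)}, ?_, ?_, ?_, ?_, ?_⟩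
  · intro p hp
    obtain ⟨p', hp', rfl⟩ := List.mem_map.mp hp
    exact c1 p' hp'
  · rw [List.map_map]; exact c2
  · rw [LEn_scale]
    have h1 : LEn L ≤ (k:ℝ) ^ 2 := by
      refine c3.trans (le_of_eq ?_)
      simp
    calc a ^ 2 * LEn L ≤ a ^ 2 * (k:ℝ) ^ 2 := by gcongr
      _ = s ^ 2 := by rw [ha]; field_simp
      _ ≤ ε := hs2.le
  · have hItg := integrable_exp_neg u c4 c5 Set.univ
    rw [Measure.restrict_univ] at hItg c7
    have h := mul_meas_ge_le_integral_of_nonneg (μ := mu0) (f := fun x => Real.exp (-u x))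
      (Eventually.of_forall fun x => (Real.exp_pos _).le) hItg (X ^ k)⁻¹
    have h2 := h.trans c7
    rw [inv_mul_le_iff₀ hXk, probReal_univ, mul_one, mul_add] at h2
    have h3 : X ^ k * qc ^ k ^ 2 ≤ ε / 2 := by
      have e : X ^ k * qc ^ k ^ 2 = (X * qc ^ k) ^ k := by rw [mul_pow, ← pow_mul, sq]
      rw [e]
      refine le_trans ?_ hk2.le
      gcongr
    have h4 : X ^ k * (ε / 2 / X ^ k) = ε / 2 := by field_simp
    linarith
  · intro x hx
    have hx' : Real.exp (-u x) < (X ^ k)⁻¹ := not_le.mp hx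
    rw [hX, ← Real.exp_nat_mul, ← Real.exp_neg, Real.exp_lt_exp] at hx'
    obtain ⟨p, hp, hp'⟩ := c6 x
    refine ⟨p.map fun p => (p.1, (a:ℂ) * p.2), hp.map _, ?_⟩
    rw [LS_scale, Complex.re_ofReal_mul]
    have h1 : (k:ℝ) * (1/s) ≤ (LS p x).re := by linarith
    calc (1:ℝ) = a * (k * (1/s)) := by rw [ha]; field_simp
      _ ≤ _ := by gcongr

lemma exists_block (ε : ℝ) (hε : 0 < ε) (B : ℤ) :
    ∃ (L : List (ℤ × ℂ)) (Z : Set UnitAddCircle), L ≠ [] ∧ (∀ p ∈ L, B < p.1) ∧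
      (L.map Prod.fst).Nodup ∧ LEn L ≤ ε ∧ mu0.real Z ≤ ε ∧
      ∀ x, x ∉ Z → ∃ p, p <+: L ∧ 1 ≤ (LS p x).re := by
  obtain ⟨L, Z, h1, h2, h3, h4, h5⟩ := exists_block0 ε hε (B+1)
  refine ⟨(B+1, 0) :: L, Z, by simp, ?_, ?_, ?_, h4, ?_⟩
  · intro p hp
    rcases List.mem_cons.mp hp with rfl | hp
    · simp
    · have := h1 p hp; omega
  · rw [List.map_cons, List.nodup_cons]
    refine ⟨?_, h2⟩
    intro hm
    obtain ⟨p, hp, he⟩ := List.mem_map.mp hm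
    have := h1 p hp
    simp only at he
    omega
  · simpa [LEn] using h3
  · intro x hx
    obtain ⟨p, hp, hp'⟩ := h5 x hx
    refine ⟨(B+1, 0) :: p, by simpa using hp, ?_⟩
    simpa [LS] using hp'

lemma exists_P (D : ℤ) : ∃ (P : ℕ → List (ℤ × ℂ)) (Z : ℕ → Set UnitAddCircle),
    (∀ j, P j <+: P (j+1)) ∧ (∀ j, j ≤ (P j).length) ∧ (∀ j, ((P j).map Prod.fst).Nodup) ∧
    (∀ j, ∀ p ∈ P j, D ≤ p.1) ∧ (∀ j, LEn (P j) ≤ 2) ∧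
    (∀ j, mu0 (Z j) ≤ ENNReal.ofReal ((1/2:ℝ) ^ j)) ∧
    ∀ j x, x ∉ Z j → ∃ p, (P j ++ p) <+: P (j+1) ∧ 1 ≤ (LS p x).re := by
  choose Lf Zf f1 f2 f3 f4 f5 f6 using fun (j : ℕ) (B : ℤ) =>
    exists_block ((1/2:ℝ) ^ j) (by positivity) B
  choose Bd g1 g2 using fun L : List (ℤ × ℂ) => exists_bound L D
  let P : ℕ → List (ℤ × ℂ) := fun j =>
    Nat.rec (motive := fun _ => List (ℤ × ℂ)) [] (fun j L => L ++ Lf j (Bd L)) j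
  have hP : ∀ j, P (j+1) = P j ++ Lf j (Bd (P j)) := fun j => rfl
  have hP0 : P 0 = [] := rfl
  refine ⟨P, fun j => Zf j (Bd (P j)), ?_, ?_, ?_, ?_, ?_, ?_, ?_⟩
  · intro j; rw [hP]; exact List.prefix_append _ _
  · intro j
    induction j with
    | zero => simp
    | succ j ih =>
      rw [hP, List.length_append]
      have := List.length_pos_iff.mpr (f1 j (Bd (P j)))
      omega
  · intro j
    induction j with
    | zero => simp [hP0]
    | succ j ih =>
      rw [hP]; exact nodup_app (Bd (P j)) ih (f3 _ _) (g2 _) (f2 _ _)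
  · intro j
    induction j with
    | zero => simp [hP0]
    | succ j ih =>
      rw [hP]
      intro p hp
      rcases List.mem_append.mp hp with hp | hp
      · exact ih p hp
      · exact ((g1 _).trans_lt (f2 _ _ p hp)).le
  · intro j
    have : LEn (P j) ≤ 2 - 2 * (1/2:ℝ) ^ j := by
      induction j with
      | zero => simp [hP0, LEn]
      | succ j ih =>
        rw [hP, LEn_append, pow_succ]
        have := f4 j (Bd (P j))
        linarith
    have h0 : (0:ℝ) < (1/2) ^ j := by positivity
    linarith
  · intro j
    rw [← ofReal_measureReal]
    exact ENNReal.ofReal_le_ofReal (f5 _ _)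
  · intro j x hx
    obtain ⟨p, hp, hp'⟩ := f6 j (Bd (P j)) x hx
    exact ⟨p, by rw [hP]; exact (List.prefix_append_right_inj _).mpr hp, hp'⟩

lemma expi_eq (m : ℤ) (x : ℝ) : expi m x = fourier m (x : UnitAddCircle) := by
  rw [fourier_coe_apply]; simp [expi]

lemma exists_div (D : ℤ) : ∃ c : ℤ → ℂ, Summable (fun m : ℤ => ‖c m‖ ^ 2) ∧
    ∃ Γ : ℕ → Finset ℤ, Monotone Γ ∧ (∀ i, ∀ m ∈ Γ i, D ≤ m) ∧
      ∀ᵐ x ∂(volume.restrict (Set.Ioo (0:ℝ) 1)),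
        ¬ ∃ L : ℂ, Tendsto (fun i => ∑ m ∈ Γ i, c m * expi m x) atTop (𝓝 L) := by
  obtain ⟨P, Z, h1, h2, h3, h4, h5, h6, h7⟩ := exists_P D
  have hmono : ∀ i j, i ≤ j → P i <+: P j := by
    intro i j hij
    induction hij with
    | refl => exact List.prefix_rfl
    | step _ ih => exact ih.trans (h1 _)
  have huniq : ∀ i j m a b, (m, a) ∈ P i → (m, b) ∈ P j → a = b := by
    intro i j m a b ha hb
    have ha' := (hmono i (max i j) (le_max_left _ _)).subset ha
    have hb' := (hmono j (max i j) (le_max_right _ _)).subset hb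
    have := List.inj_on_of_nodup_map (h3 (max i j)) ha' hb' rfl
    simpa using this
  classical
  set c : ℤ → ℂ := fun m => if h : ∃ a, ∃ j, (m, a) ∈ P j then h.choose else 0 with hc
  have hcP : ∀ j, ∀ p ∈ P j, c p.1 = p.2 := by
    intro j p hp
    have h : ∃ a, ∃ j, (p.1, a) ∈ P j := ⟨p.2, j, hp⟩
    obtain ⟨i, hi⟩ := h.choose_spec
    simp only [hc, dif_pos h]
    exact huniq i j _ _ _ hi hp
  have hc0 : ∀ m, c m ≠ 0 → ∃ j, m ∈ (P j).map Prod.fst := by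
    intro m hm
    by_cases h : ∃ a, ∃ j, (m, a) ∈ P j
    · obtain ⟨a, j, hj⟩ := h
      exact ⟨j, List.mem_map.mpr ⟨_, hj, rfl⟩⟩
    · exact absurd (by simp only [hc, dif_neg h]) hm
  refine ⟨c, ?_, fun i => (((P i).take i).map Prod.fst).toFinset, ?_, ?_, ?_⟩
  · apply summable_of_sum_le (c := 2) (fun m => by positivity)
    intro s
    have hex : ∃ j, ∀ m ∈ s, c m ≠ 0 → m ∈ (P j).map Prod.fst := by
      induction s using Finset.induction_on with
      | empty => exact ⟨0, by simp⟩
      | insert a s _ ih =>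
        obtain ⟨j, hj⟩ := ih
        by_cases ha : c a = 0
        · refine ⟨j, fun m hm hcm => ?_⟩
          rcases Finset.mem_insert.mp hm with rfl | hm
          · exact absurd ha hcm
          · exact hj m hm hcm
        · obtain ⟨i, hi⟩ := hc0 a ha
          refine ⟨max i j, fun m hm hcm => ?_⟩
          rcases Finset.mem_insert.mp hm with rfl | hm
          · exact ((hmono i _ (le_max_left _ _)).map Prod.fst).subset hi
          · exact ((hmono j _ (le_max_right _ _)).map Prod.fst).subset (hj m hm hcm)
    obtain ⟨j, hj⟩ := hex
    calc ∑ m ∈ s, ‖c m‖ ^ 2 = ∑ m ∈ s with c m ≠ 0, ‖c m‖ ^ 2 := by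
          rw [Finset.sum_filter]
          apply Finset.sum_congr rfl
          intro m _
          by_cases h : c m = 0 <;> simp [h]
      _ ≤ ∑ m ∈ ((P j).map Prod.fst).toFinset, ‖c m‖ ^ 2 := by
          apply Finset.sum_le_sum_of_subset_of_nonneg
          · intro m hm
            obtain ⟨hm1, hm2⟩ := Finset.mem_filter.mp hm
            exact List.mem_toFinset.mpr (hj m hm1 hm2)
          · intros; positivity
      _ = LEn (P j) := by
          rw [List.sum_toFinset _ (h3 j), List.map_map, LEn]
          congr 1
          apply List.map_congr_left
          intro p hp
          simp only [Function.comp, hcP j p hp]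
      _ ≤ 2 := h5 j
  · apply monotone_nat_of_le_succ
    intro i m hm
    rw [List.mem_toFinset] at hm ⊢
    have : (P i).take i <+: (P (i+1)).take (i+1) :=
      ((h1 i).take i).trans (List.take_prefix_take_left (Nat.le_succ i))
    exact (this.map Prod.fst).subset hm
  · intro i m hm
    rw [List.mem_toFinset] at hm
    obtain ⟨p, hp, rfl⟩ := List.mem_map.mp hm
    exact h4 i p (List.mem_of_mem_take hp)
  · have hS : ∀ i (x : ℝ), ∑ m ∈ (((P i).take i).map Prod.fst).toFinset, c m * expi m x =
        LS ((P i).take i) (x : UnitAddCircle) := by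
      intro i x
      rw [List.sum_toFinset _ (((List.take_sublist i (P i)).map Prod.fst).nodup (h3 i)),
        List.map_map, LS]
      congr 1
      apply List.map_congr_left
      intro p hp
      simp only [Function.comp, hcP i p (List.mem_of_mem_take hp), expi_eq]
    have htake : ∀ Q j, Q <+: P j → (P Q.length).take Q.length = Q := by
      intro Q j hQ
      have e1 : Q <+: P (max j Q.length) := hQ.trans (hmono _ _ (le_max_left _ _))
      have e2 := hmono _ _ (le_max_right j Q.length)
      have e3 : (P Q.length).take Q.length <+: P (max j Q.length) :=
        (List.take_prefix _ _).trans e2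
      have e4 : ((P Q.length).take Q.length).length = Q.length := by
        rw [List.length_take]; exact min_eq_left (h2 _)
      exact (List.prefix_of_prefix_length_le e3 e1 e4.le).eq_of_length e4
    have hae : ∀ᵐ y ∂mu0, ∀ᶠ j in atTop, y ∉ Z j := by
      apply ae_eventually_notMem
      apply ne_of_lt
      refine lt_of_le_of_lt (ENNReal.tsum_le_tsum h6) ?_
      rw [← ENNReal.ofReal_tsum_of_nonneg (fun j => by positivity)
        (summable_geometric_of_lt_one (by norm_num) (by norm_num))]
      exact ENNReal.ofReal_lt_top
    have hvol : (volume : Measure UnitAddCircle) = mu0 := by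
      rw [AddCircle.volume_eq_smul_haarAddCircle]; simp
    rw [← hvol] at hae
    have hae2 := (UnitAddCircle.measurePreserving_mk 0).quasiMeasurePreserving.ae hae
    have hae3 := ae_restrict_of_ae_restrict_of_subset (s := Set.Ioo (0:ℝ) 1) (by
      intro x hx; exact ⟨hx.1, by linarith [hx.2]⟩) hae2
    filter_upwards [hae3] with x hx
    rintro ⟨l, hl⟩
    have hcau := hl.cauchySeq
    rw [Metric.cauchySeq_iff] at hcau
    obtain ⟨N, hN⟩ := hcau 1 one_pos
    obtain ⟨j, hj, hjN⟩ := (hx.and (eventually_ge_atTop N)).exists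
    obtain ⟨p, hp, hp1⟩ := h7 j _ hj
    have hlen := h2 j
    have := hN (P j ++ p).length (by rw [List.length_append]; omega) (P j).length (by omega)
    rw [dist_eq_norm, hS, hS, htake _ _ hp, htake _ j List.prefix_rfl, LS_append,
      add_sub_cancel_left] at this
    have h8 := (le_abs_self _).trans (Complex.abs_re_le_norm (LS p (x : UnitAddCircle)))
    have h9 : 1 ≤ (LS p (x : UnitAddCircle)).re := hp1
    linarith

/-- **Corollary 1 (sharpness part).** For every `l ≥ 2` there is a `λ_l`-lacunary sequence `N`
(where `λ_l > 1` solves `x^{l-1} = x^{l-2} + ⋯ + x + 1`), coefficients with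
`∑_{m ∈ N(l)} |c_m|² < ∞` and an increasing sequence of finite sets `Γ_n ⊆ N(l)` such that
the sums `∑_{m ∈ Γ_n} c_m e^{2πimx}` diverge a.e. on `(0,1)`. -/
theorem statement2 (l : ℕ) (hl : 2 ≤ l)
    (laml : ℝ) (hlaml : 1 < laml)
    (hlameq : laml ^ (l - 1) = ∑ i ∈ Finset.range (l - 1), laml ^ i) :
    ∃ n : ℕ → ℕ, IsLacunary laml n ∧
      ∃ c : ℤ → ℂ, Summable (fun m : SignedSums n l => ‖c (m : ℤ)‖ ^ 2) ∧
        ∃ Γ : ℕ → Finset ℤ, Monotone Γ ∧ (∀ i, ↑(Γ i) ⊆ SignedSums n l) ∧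
          ∀ᵐ x ∂(volume.restrict (Set.Ioo (0:ℝ) 1)),
            ¬ ∃ L : ℂ, Tendsto (fun i => ∑ m ∈ Γ i, c m * expi m x) atTop (𝓝 L) := by
  obtain ⟨r, rfl⟩ := Nat.exists_eq_add_of_le' hl
  obtain ⟨n, hn, D, hD⟩ := exists_seq laml hlaml r hlameq
  obtain ⟨c, hc, Γ, hΓ, hΓD, hdiv⟩ := exists_div D
  exact ⟨n, hn, c, hc.subtype _, Γ, hΓ, fun i m hm => hD m (hΓD i m hm), hdiv⟩
end
end

section
/- Let l ≥ 1 be an integer and let {m_k} be any enumeration of the set D*(l). Then the trigonometric system {e^{2πi m_k x}} is an unconditional convergence system: if complex coefficients satisfy ∑_k |c_k|² < ∞, then for every permutation σ of the positive integers the series ∑_k c_{σ(k)} e^{2πi m_{σ(k)} x} converges for almost every x ∈ (0,1). -/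
open MeasureTheory Filter Finset Topology

noncomputable section

/-- `D(s)`: positive integers `m = 2^{k₁} + ⋯ + 2^{k_s}` with `k₁ > ⋯ > k_s ≥ 1`. -/
def DyadicSums (s : ℕ) : Set ℕ :=
  {m | ∃ k : Fin s → ℕ, StrictAnti k ∧ (∀ j, 1 ≤ k j) ∧ m = ∑ j, 2 ^ (k j)}

/-- `D*(l) = ⋃_{1 ≤ s ≤ l} D(s)`. -/
def DyadicStar (l : ℕ) : Set ℕ := ⋃ s ∈ Set.Icc 1 l, DyadicSums s

theorem aux_comb (r : ℕ) : ∀ n : ℕ, ∃ F : Finset (ℕ × ℕ), F.card ≤ 4 ^ r ∧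
    ∀ A B : Finset ℕ, A.card + B.card ≤ r → ∑ k ∈ A, 2 ^ k + ∑ k ∈ B, 2 ^ k = n →
      (∑ k ∈ A, 2 ^ k, ∑ k ∈ B, 2 ^ k) ∈ F := by
  induction r with
  | zero =>
    intro n
    refine ⟨{(0, 0)}, by simp, ?_⟩
    intro A B h _
    have hA : A = ∅ := by rw [← Finset.card_eq_zero]; omega
    have hB : B = ∅ := by rw [← Finset.card_eq_zero]; omega
    simp [hA, hB]
  | succ r ih =>
    intro n
    choose F hFc hF using ih
    let P : ℕ → Finset (ℕ × ℕ) := fun k =>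
      (F (n - 2 ^ k)).image (fun p => (p.1 + 2 ^ k, p.2)) ∪
      (F (n - 2 ^ k)).image (fun p => (p.1, p.2 + 2 ^ k))
    have hP : ∀ k, (P k).card ≤ 2 * 4 ^ r := by
      intro k
      refine (Finset.card_union_le _ _).trans ?_
      have h1 := (Finset.card_image_le (s := F (n - 2 ^ k)) (f := fun p => (p.1 + 2 ^ k, p.2))).trans (hFc _)
      have h2 := (Finset.card_image_le (s := F (n - 2 ^ k)) (f := fun p => (p.1, p.2 + 2 ^ k))).trans (hFc _)
      omega
    by_cases hn : n = 0
    · refine ⟨{(0, 0)}, by simpa using Nat.one_le_pow _ _ (by norm_num), ?_⟩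
      intro A B _ h
      simp only [Finset.mem_singleton, Prod.mk.injEq]
      omega
    refine ⟨P (Nat.log 2 n) ∪ P (Nat.log 2 n - 1), ?_, ?_⟩
    · refine (Finset.card_union_le _ _).trans ?_
      have h1 := hP (Nat.log 2 n)
      have h2 := hP (Nat.log 2 n - 1)
      rw [pow_succ]; omega
    intro A B hc hs
    have hne : (A ∪ B).Nonempty := by
      rw [Finset.nonempty_iff_ne_empty]
      intro h
      rw [Finset.union_eq_empty] at h
      rw [h.1, h.2] at hs
      simp at hs
      omega
    set k := (A ∪ B).max' hne with hk
    have hkm : k ∈ A ∪ B := Finset.max'_mem _ _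
    have hle : ∀ i ∈ A ∪ B, i ≤ k := fun i hi => Finset.le_max' _ _ hi
    have hbd : ∀ C : Finset ℕ, C ⊆ A ∪ B → ∑ i ∈ C, 2 ^ i < 2 ^ (k + 1) := by
      intro C hC
      refine Nat.geomSum_lt le_rfl ?_
      intro i hi
      exact Nat.lt_succ_of_le (hle i (hC hi))
    have hA := hbd A Finset.subset_union_left
    have hB := hbd B Finset.subset_union_right
    have hlow : 2 ^ k ≤ n := by
      rcases Finset.mem_union.1 hkm with h | h
      · have := Finset.single_le_sum (f := fun i => 2 ^ i) (fun i _ => Nat.zero_le _) h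
        omega
      · have := Finset.single_le_sum (f := fun i => 2 ^ i) (fun i _ => Nat.zero_le _) h
        omega
    have hup : n < 2 ^ (k + 2) := by
      rw [pow_succ 2 (k + 1)]; omega
    have h1 : k ≤ Nat.log 2 n := Nat.le_log_of_pow_le (by norm_num) hlow
    have h2 : Nat.log 2 n < k + 2 := Nat.log_lt_of_lt_pow hn hup
    have key : (∑ k ∈ A, 2 ^ k, ∑ k ∈ B, 2 ^ k) ∈ P k := by
      simp only [P, Finset.mem_union, Finset.mem_image]
      rcases Finset.mem_union.1 hkm with h | h
      · left
        have e := Finset.sum_erase_add A (fun i => 2 ^ i) h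
        have e2 := Finset.card_erase_add_one h
        refine ⟨(∑ i ∈ A.erase k, 2 ^ i, ∑ i ∈ B, 2 ^ i), hF _ _ _ (by omega) ?_, ?_⟩
        · omega
        · simp only [e]
      · right
        have e := Finset.sum_erase_add B (fun i => 2 ^ i) h
        have e2 := Finset.card_erase_add_one h
        refine ⟨(∑ i ∈ A, 2 ^ i, ∑ i ∈ B.erase k, 2 ^ i), hF _ _ _ (by omega) ?_, ?_⟩
        · omega
        · simp only [e]
    rw [Finset.mem_union]
    have : k = Nat.log 2 n ∨ k = Nat.log 2 n - 1 := by omega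
    rcases this with h | h
    · left; rw [← h]; exact key
    · right; rw [← h]; exact key

theorem aux_star {l n : ℕ} (h : n ∈ DyadicStar l) :
    ∃ A : Finset ℕ, A.card ≤ l ∧ n = ∑ k ∈ A, 2 ^ k := by
  simp only [DyadicStar, DyadicSums, Set.mem_iUnion, Set.mem_Icc, Set.mem_ofPred_eq] at h
  obtain ⟨s, hs, k, hk, -, rfl⟩ := h
  refine ⟨Finset.univ.image k, ?_, ?_⟩
  · exact Finset.card_image_le.trans (by simpa using hs.2)
  · rw [Finset.sum_image (fun a _ b _ hab => hk.injective hab)]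

theorem aux_pairs (l : ℕ) (n : ℕ → ℕ) (hinj : Function.Injective n)
    (hn : ∀ k, n k ∈ DyadicStar l) (s : Finset ℕ) (t : ℕ) :
    ((s ×ˢ s).filter (fun p => n p.1 + n p.2 = t)).card ≤ 4 ^ (2 * l) := by
  obtain ⟨F, hFc, hF⟩ := aux_comb (2 * l) t
  refine le_trans (Finset.card_le_card_of_injOn (fun p => (n p.1, n p.2)) ?_ ?_) hFc
  · intro p hp
    have hp := (Finset.mem_filter.1 hp).2
    obtain ⟨A, hA, eA⟩ := aux_star (hn p.1)
    obtain ⟨B, hB, eB⟩ := aux_star (hn p.2)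
    have := hF A B (by omega) (by rw [← eA, ← eB]; exact hp)
    rw [← eA, ← eB] at this
    exact this
  · intro p _ q _ h
    simp only [Prod.mk.injEq] at h
    exact Prod.ext (hinj h.1) (hinj h.2)

theorem expi_add (a b : ℤ) (x : ℝ) : expi a x * expi b x = expi (a + b) x := by
  unfold expi
  rw [← Complex.exp_add]
  congr 1
  push_cast
  ring

theorem expi_conj (a : ℤ) (x : ℝ) : (starRingEnd ℂ) (expi a x) = expi (-a) x := by
  unfold expi
  rw [← Complex.exp_conj]
  congr 1
  have h2 : (starRingEnd ℂ) (2 : ℂ) = 2 := Complex.conj_ofNat 2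
  simp [h2]

theorem expi_cont (a : ℤ) : Continuous (expi a) := by
  unfold expi
  fun_prop

theorem expi_int (a : ℤ) : ∫ x in (0:ℝ)..1, expi a x = if a = 0 then 1 else 0 := by
  unfold expi
  split_ifs with h
  · simp [h]
  · have hc : (2 * Real.pi * Complex.I * a : ℂ) ≠ 0 := by
      have : (Real.pi : ℂ) ≠ 0 := by exact_mod_cast Real.pi_ne_zero
      have : (a : ℂ) ≠ 0 := by exact_mod_cast h
      simp [*]
    rw [integral_exp_mul_complex hc]
    have : (2 * Real.pi * Complex.I * a * (1:ℝ) : ℂ) = a * (2 * Real.pi * Complex.I) := by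
      push_cast; ring
    rw [this, Complex.exp_int_mul_two_pi_mul_I]
    simp

theorem aux_parseval (T : Finset ℕ) (d : ℕ → ℂ) :
    ∫ x in (0:ℝ)..1, ‖∑ t ∈ T, d t * expi t x‖ ^ 2 = ∑ t ∈ T, ‖d t‖ ^ 2 := by
  have h : ∀ x : ℝ, ((‖∑ t ∈ T, d t * expi t x‖ ^ 2 : ℝ) : ℂ) =
      ∑ t ∈ T, ∑ u ∈ T, (d t * (starRingEnd ℂ) (d u)) * expi ((t : ℤ) - u) x := by
    intro x
    push_cast
    rw [← Complex.mul_conj', map_sum, Finset.sum_mul_sum]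
    refine Finset.sum_congr rfl fun t _ => Finset.sum_congr rfl fun u _ => ?_
    rw [map_mul, expi_conj, sub_eq_add_neg, ← expi_add]
    ring
  have h2 : ((∫ x in (0:ℝ)..1, ‖∑ t ∈ T, d t * expi t x‖ ^ 2 : ℝ) : ℂ) =
      ((∑ t ∈ T, ‖d t‖ ^ 2 : ℝ) : ℂ) := by
    rw [← intervalIntegral.integral_ofReal]
    simp_rw [h]
    rw [intervalIntegral.integral_finsetSum]
    · push_cast
      refine Finset.sum_congr rfl fun t ht => ?_
      rw [intervalIntegral.integral_finsetSum]
      · simp_rw [intervalIntegral.integral_const_mul, expi_int]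
        rw [Finset.sum_eq_single t]
        · simp [Complex.mul_conj']
        · intro u _ hu
          have : ¬ ((t : ℤ) - u = 0) := by omega
          simp [this]
        · intro h; exact absurd ht h
      · intro u _
        exact (continuous_const.mul (expi_cont _)).intervalIntegrable _ _
    · intro t _
      exact (continuous_finsetSum _ fun u _ =>
        continuous_const.mul (expi_cont _)).intervalIntegrable _ _
  exact_mod_cast h2

theorem aux_L4 (l : ℕ) (n : ℕ → ℕ) (hinj : Function.Injective n)
    (hn : ∀ k, n k ∈ DyadicStar l) (s : Finset ℕ) (a : ℕ → ℂ) :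
    ∫ x in (0:ℝ)..1, ‖∑ k ∈ s, a k * expi (n k) x‖ ^ 4 ≤
      (4 ^ (2 * l) : ℝ) * (∑ k ∈ s, ‖a k‖ ^ 2) ^ 2 := by
  classical
  set T := (s ×ˢ s).image (fun p => n p.1 + n p.2) with hT
  set d : ℕ → ℂ := fun t => ∑ p ∈ (s ×ˢ s).filter (fun p => n p.1 + n p.2 = t), a p.1 * a p.2 with hd
  have h : ∀ x : ℝ, ‖∑ k ∈ s, a k * expi (n k) x‖ ^ 4 = ‖∑ t ∈ T, d t * expi t x‖ ^ 2 := by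
    intro x
    have e : (∑ k ∈ s, a k * expi (n k) x) ^ 2 = ∑ t ∈ T, d t * expi t x := by
      rw [sq, Finset.sum_mul_sum, ← Finset.sum_product',
        ← Finset.sum_fiberwise_of_maps_to (t := T) (g := fun p => n p.1 + n p.2)
          (fun p hp => Finset.mem_image_of_mem _ hp)]
      refine Finset.sum_congr rfl fun t _ => ?_
      rw [hd, Finset.sum_mul]
      refine Finset.sum_congr rfl fun p hp => ?_
      rw [← (Finset.mem_filter.1 hp).2]
      push_cast
      rw [← expi_add]
      ring
    rw [← e, norm_pow]
    ring
  simp_rw [h]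
  rw [aux_parseval]
  have hb : ∀ t, ‖d t‖ ^ 2 ≤ (4 ^ (2 * l) : ℝ) *
      ∑ p ∈ (s ×ˢ s).filter (fun p => n p.1 + n p.2 = t), ‖a p.1‖ ^ 2 * ‖a p.2‖ ^ 2 := by
    intro t
    have h1 : ‖d t‖ ≤ ∑ p ∈ (s ×ˢ s).filter (fun p => n p.1 + n p.2 = t), ‖a p.1 * a p.2‖ :=
      norm_sum_le _ _
    have h2 := sq_sum_le_card_mul_sum_sq (s := (s ×ˢ s).filter (fun p => n p.1 + n p.2 = t))
      (f := fun p => ‖a p.1 * a p.2‖)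
    have h3 : (((s ×ˢ s).filter (fun p => n p.1 + n p.2 = t)).card : ℝ) ≤ 4 ^ (2 * l) := by
      exact_mod_cast aux_pairs l n hinj hn s t
    calc ‖d t‖ ^ 2 ≤ _ := pow_le_pow_left₀ (norm_nonneg _) h1 2
      _ ≤ _ := h2
      _ ≤ (4 ^ (2 * l) : ℝ) * _ := mul_le_mul_of_nonneg_right h3
          (Finset.sum_nonneg fun _ _ => sq_nonneg _)
      _ = _ := by simp_rw [norm_mul, mul_pow]
  refine (Finset.sum_le_sum fun t _ => hb t).trans (le_of_eq ?_)
  have e := Finset.sum_fiberwise_of_maps_to (s := s ×ˢ s) (t := T) (g := fun p => n p.1 + n p.2)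
    (fun p hp => Finset.mem_image_of_mem _ hp) (fun p => ‖a p.1‖ ^ 2 * ‖a p.2‖ ^ 2)
  rw [← Finset.mul_sum, e, sq (∑ k ∈ s, ‖a k‖ ^ 2), Finset.sum_mul_sum, ← Finset.sum_product']

theorem aux_L4' (l : ℕ) (n : ℕ → ℕ) (hinj : Function.Injective n)
    (hn : ∀ k, n k ∈ DyadicStar l) (s : Finset ℕ) (a : ℕ → ℂ) :
    ∫⁻ x in Set.Ioo (0:ℝ) 1, ‖∑ k ∈ s, a k * expi (n k) x‖ₑ ^ 4 ≤
      ENNReal.ofReal ((4 ^ (2 * l) : ℝ) * (∑ k ∈ s, ‖a k‖ ^ 2) ^ 2) := by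
  have hcont : Continuous fun x : ℝ => ‖∑ k ∈ s, a k * expi (n k) x‖ ^ 4 :=
    (continuous_finsetSum _ fun u _ => continuous_const.mul (expi_cont _)).norm.pow 4
  have h := aux_L4 l n hinj hn s a
  rw [intervalIntegral.integral_of_le zero_le_one, integral_Ioc_eq_integral_Ioo] at h
  have hi : Integrable (fun x : ℝ => ‖∑ k ∈ s, a k * expi (n k) x‖ ^ 4)
      (volume.restrict (Set.Ioo (0:ℝ) 1)) :=
    (hcont.integrableOn_Icc (a := 0) (b := 1)).mono_set Set.Ioo_subset_Icc_self
  refine le_trans (le_of_eq ?_) (ENNReal.ofReal_le_ofReal h)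
  rw [ofReal_integral_eq_lintegral_ofReal hi (ae_of_all _ fun x => by positivity)]
  refine lintegral_congr fun x => ?_
  rw [ENNReal.ofReal_pow (norm_nonneg _), ofReal_norm]

theorem aux_four (a b : ENNReal) : 2 * (a + b) ^ 4 ≤ 4000 * a ^ 4 + 3 * b ^ 4 := by
  by_cases ha : a = ⊤
  · simp [ha, ENNReal.mul_top]
  by_cases hb : b = ⊤
  · simp [hb, ENNReal.mul_top]
  lift a to NNReal using ha
  lift b to NNReal using hb
  norm_cast
  rw [← NNReal.coe_le_coe]
  push_cast
  generalize (a : ℝ) = x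
  generalize (b : ℝ) = y
  have h1 : (x + y) ^ 2 ≤ 11 * x ^ 2 + 11 / 10 * y ^ 2 := by
    nlinarith [sq_nonneg (10 * x - y)]
  have h2 : ((x + y) ^ 2) ^ 2 ≤ (11 * x ^ 2 + 11 / 10 * y ^ 2) ^ 2 :=
    pow_le_pow_left₀ (sq_nonneg _) h1 2
  nlinarith [sq_nonneg (10 * x ^ 2 * 11 - y ^ 2 * (11 / 10)), sq_nonneg (x ^ 2), sq_nonneg (y ^ 2),
    sq_nonneg (100 * x ^ 2 - y ^ 2), h2]

/-- maximal partial sums -/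
def maxPS {Ω : Type*} (f : ℕ → Ω → ℂ) (a b : ℕ) (x : Ω) : ENNReal :=
  (Finset.Icc a b).sup (fun j => ‖∑ k ∈ Finset.Ico a j, f k x‖ₑ)

theorem maxPS_split {Ω : Type*} (f : ℕ → Ω → ℂ) (a j b : ℕ) (haj : a ≤ j) (x : Ω) :
    maxPS f a b x ≤ ‖∑ k ∈ Finset.Ico a (j + 1), f k x‖ₑ +
      max (maxPS f a j x) (maxPS f (j + 1) b x) := by
  refine Finset.sup_le fun i hi => ?_
  rw [Finset.mem_Icc] at hi
  by_cases hij : i ≤ j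
  · refine le_trans ?_ (le_trans (le_max_left _ _) le_add_self)
    exact Finset.le_sup (f := fun j => ‖∑ k ∈ Finset.Ico a j, f k x‖ₑ)
      (Finset.mem_Icc.2 ⟨hi.1, hij⟩)
  · rw [← Finset.sum_Ico_consecutive _ (show a ≤ j + 1 by omega) (show j + 1 ≤ i by omega)]
    refine (enorm_add_le _ _).trans (add_le_add le_rfl (le_trans ?_ (le_max_right _ _)))
    exact Finset.le_sup (f := fun i => ‖∑ k ∈ Finset.Ico (j + 1) i, f k x‖ₑ)
      (Finset.mem_Icc.2 ⟨by omega, hi.2⟩)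

theorem maxPS_meas {Ω : Type*} [MeasurableSpace Ω] (f : ℕ → Ω → ℂ)
    (hf : ∀ k, Measurable (f k)) (a b : ℕ) : Measurable (maxPS f a b) := by
  unfold maxPS
  simp only [Finset.sup_eq_iSup]
  refine Measurable.iSup fun j => Measurable.iSup fun _ => ?_
  fun_prop

theorem maxPS_int {Ω : Type*} [MeasurableSpace Ω] (μ : Measure Ω) (f : ℕ → Ω → ℂ)
    (hf : ∀ k, Measurable (f k)) (w : ℕ → ℝ) (hw : ∀ k, 0 ≤ w k) (B : ℝ) (hB : 0 ≤ B)
    (h : ∀ a b, ∫⁻ x, ‖∑ k ∈ Finset.Ico a b, f k x‖ₑ ^ 4 ∂μ ≤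
      ENNReal.ofReal (B * (∑ k ∈ Finset.Ico a b, w k) ^ 2)) (r : ℕ) :
    ∀ a b, b ≤ a + r → ∫⁻ x, maxPS f a b x ^ 4 ∂μ ≤
      ENNReal.ofReal (8000 * B * (∑ k ∈ Finset.Ico a b, w k) ^ 2) := by
  induction r with
  | zero =>
    intro a b hab
    have : ∀ x, maxPS f a b x = 0 := by
      intro x
      refine le_antisymm (Finset.sup_le fun i hi => ?_) (zero_le)
      rw [Finset.mem_Icc] at hi
      have : Finset.Ico a i = ∅ := Finset.Ico_eq_empty_of_le (by omega)
      simp [this]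
    simp [this]
  | succ r ih =>
    intro a b hab
    by_cases hlt : b ≤ a
    · exact ih a b (by omega)
    push Not at hlt
    set A := ∑ k ∈ Finset.Ico a b, w k with hA
    have hA0 : 0 ≤ A := Finset.sum_nonneg fun _ _ => hw _
    have hex : ∃ j, a ≤ j ∧ A / 2 ≤ ∑ k ∈ Finset.Ico a (j + 1), w k :=
      ⟨b - 1, by omega, by rw [show b - 1 + 1 = b by omega]; linarith⟩
    classical
    set j := Nat.find hex with hj
    obtain ⟨haj, hj2⟩ := Nat.find_spec hex
    rw [← hj] at haj hj2
    have hjb : j ≤ b - 1 := Nat.find_min' hex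
      ⟨by omega, by rw [show b - 1 + 1 = b by omega]; linarith⟩
    have hL : ∑ k ∈ Finset.Ico a j, w k ≤ A / 2 := by
      by_contra hcon
      push Not at hcon
      have hne : a < j := by
        by_contra hx
        have : Finset.Ico a j = ∅ := Finset.Ico_eq_empty_of_le (by omega)
        rw [this] at hcon
        simp at hcon
        linarith
      exact Nat.find_min hex (m := j - 1) (by omega)
        ⟨by omega, by rw [show j - 1 + 1 = j by omega]; exact hcon.le⟩
    have hs := Finset.sum_Ico_consecutive w (show a ≤ j + 1 by omega) (show j + 1 ≤ b by omega)
    rw [← hA] at hs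
    have hR : ∑ k ∈ Finset.Ico (j + 1) b, w k ≤ A / 2 := by linarith
    have hR0 : 0 ≤ ∑ k ∈ Finset.Ico (j + 1) b, w k := Finset.sum_nonneg fun _ _ => hw _
    have hL0 : 0 ≤ ∑ k ∈ Finset.Ico a j, w k := Finset.sum_nonneg fun _ _ => hw _
    have hM0 : 0 ≤ ∑ k ∈ Finset.Ico a (j + 1), w k := Finset.sum_nonneg fun _ _ => hw _
    have iL := ih a j (by omega)
    have iR := ih (j + 1) b (by omega)
    have iM := h a (j + 1)
    have pt : ∀ x, 2 * maxPS f a b x ^ 4 ≤ 4000 * ‖∑ k ∈ Finset.Ico a (j + 1), f k x‖ₑ ^ 4 +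
        3 * (maxPS f a j x ^ 4 + maxPS f (j + 1) b x ^ 4) := by
      intro x
      calc 2 * maxPS f a b x ^ 4 ≤ 2 * (‖∑ k ∈ Finset.Ico a (j + 1), f k x‖ₑ +
            max (maxPS f a j x) (maxPS f (j + 1) b x)) ^ 4 := by
              gcongr; exact maxPS_split f a j b haj x
        _ ≤ _ := aux_four _ _
        _ ≤ _ := by
          gcongr
          rcases max_choice (maxPS f a j x) (maxPS f (j + 1) b x) with e | e <;> rw [e]
          · exact le_self_add
          · exact le_add_self
    have hmS : Measurable fun x => ‖∑ k ∈ Finset.Ico a (j + 1), f k x‖ₑ ^ 4 := by fun_prop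
    have hmL : Measurable fun x => maxPS f a j x ^ 4 := (maxPS_meas f hf a j).pow_const 4
    have hmR : Measurable fun x => maxPS f (j + 1) b x ^ 4 := (maxPS_meas f hf (j + 1) b).pow_const 4
    have hmM : Measurable fun x => maxPS f a b x ^ 4 := (maxPS_meas f hf a b).pow_const 4
    have fin : 2 * ∫⁻ x, maxPS f a b x ^ 4 ∂μ ≤ 2 * ENNReal.ofReal (8000 * B * A ^ 2) := by
      calc 2 * ∫⁻ x, maxPS f a b x ^ 4 ∂μ = ∫⁻ x, 2 * maxPS f a b x ^ 4 ∂μ :=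
            (lintegral_const_mul _ hmM).symm
        _ ≤ _ := lintegral_mono pt
        _ = 4000 * ∫⁻ x, ‖∑ k ∈ Finset.Ico a (j + 1), f k x‖ₑ ^ 4 ∂μ +
            3 * (∫⁻ x, maxPS f a j x ^ 4 ∂μ + ∫⁻ x, maxPS f (j + 1) b x ^ 4 ∂μ) := by
          rw [lintegral_add_left (hmS.const_mul _), lintegral_const_mul _ hmS,
            lintegral_const_mul _ (show Measurable fun x => maxPS f a j x ^ 4 + maxPS f (j + 1) b x ^ 4 from hmL.add hmR), lintegral_add_left hmL]
        _ ≤ ENNReal.ofReal 4000 * ENNReal.ofReal (B * A ^ 2) + ENNReal.ofReal 3 *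
            (ENNReal.ofReal (8000 * B * (A / 2) ^ 2) + ENNReal.ofReal (8000 * B * (A / 2) ^ 2)) := by
          have e1 : (4000 : ENNReal) = ENNReal.ofReal 4000 := by norm_num
          have e2 : (3 : ENNReal) = ENNReal.ofReal 3 := by norm_num
          rw [e1, e2]
          gcongr
          · exact iM.trans (ENNReal.ofReal_le_ofReal (by gcongr; linarith))
          · exact iL.trans (ENNReal.ofReal_le_ofReal (by gcongr))
          · exact iR.trans (ENNReal.ofReal_le_ofReal (by gcongr))
        _ = ENNReal.ofReal 2 * ENNReal.ofReal (8000 * B * A ^ 2) := by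
          rw [← ENNReal.ofReal_add (by positivity) (by positivity),
            ← ENNReal.ofReal_mul (by norm_num), ← ENNReal.ofReal_mul (by norm_num),
            ← ENNReal.ofReal_add (by positivity) (by positivity),
            ← ENNReal.ofReal_mul (by norm_num)]
          congr 1
          ring
        _ = _ := by norm_num
    exact (ENNReal.mul_le_mul_iff_right (by norm_num) (by norm_num)).1 fin

theorem aux_conv {Ω : Type*} [MeasurableSpace Ω] (μ : Measure Ω) (f : ℕ → Ω → ℂ)
    (hf : ∀ k, Measurable (f k)) (w : ℕ → ℝ) (hw : ∀ k, 0 ≤ w k) (hsum : Summable w)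
    (B : ℝ) (hB : 0 ≤ B)
    (h : ∀ a b, ∫⁻ x, ‖∑ k ∈ Finset.Ico a b, f k x‖ₑ ^ 4 ∂μ ≤
      ENNReal.ofReal (B * (∑ k ∈ Finset.Ico a b, w k) ^ 2)) :
    ∀ᵐ x ∂μ, ∃ L : ℂ, Tendsto (fun N => ∑ k ∈ Finset.range N, f k x) atTop (𝓝 L) := by
  set tail : ℕ → ℝ := fun N => ∑' k, w k - ∑ k ∈ Finset.range N, w k with htail
  have htt : Tendsto tail atTop (𝓝 0) := by
    have := hsum.hasSum.tendsto_sum_nat.const_sub (∑' k, w k)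
    simpa using this
  have hmono : ∀ N x, Monotone fun b => maxPS f N b x := fun N x b c hbc =>
    Finset.sup_mono (Finset.Icc_subset_Icc_right hbc)
  have hG : ∀ N, ∫⁻ x, ⨆ b, maxPS f N b x ^ 4 ∂μ ≤ ENNReal.ofReal (8000 * B * tail N ^ 2) := by
    intro N
    rw [lintegral_iSup (fun b => (maxPS_meas f hf N b).pow_const 4)
      (fun b c hbc x => pow_le_pow_left₀ (zero_le) (hmono N x hbc) 4)]
    refine iSup_le fun b => (maxPS_int μ f hf w hw B hB h b N b (by omega)).trans
      (ENNReal.ofReal_le_ofReal ?_)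
    have h0 : 0 ≤ ∑ k ∈ Finset.Ico N b, w k := Finset.sum_nonneg fun _ _ => hw _
    have h1 : ∑ k ∈ Finset.Ico N b, w k ≤ tail N := by
      have h2 : ∑ k ∈ Finset.range N, w k + ∑ k ∈ Finset.Ico N b, w k ≤ ∑' k, w k := by
        rw [← Finset.sum_union]
        · exact hsum.sum_le_tsum _ fun k _ => hw k
        · rw [Finset.disjoint_left]
          intro k hk hk'
          rw [Finset.mem_range] at hk
          rw [Finset.mem_Ico] at hk'
          omega
      simp only [htail]
      linarith
    gcongr
  have hH : ∫⁻ x, ⨅ N, ⨆ b, maxPS f N b x ^ 4 ∂μ = 0 := by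
    have ht : Tendsto (fun N => ENNReal.ofReal (8000 * B * tail N ^ 2)) atTop (𝓝 0) := by
      have := ENNReal.tendsto_ofReal ((htt.pow 2).const_mul (8000 * B))
      simpa using this
    refine le_antisymm (ge_of_tendsto' ht fun N => ?_) (zero_le)
    exact (lintegral_mono fun x => iInf_le _ N).trans (hG N)
  rw [lintegral_eq_zero_iff (Measurable.iInf fun N => Measurable.iSup fun b =>
    (maxPS_meas f hf N b).pow_const 4)] at hH
  filter_upwards [hH] with x hx
  refine cauchySeq_tendsto_of_complete ?_
  rw [Metric.cauchySeq_iff']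
  intro ε hε
  have hpos : 0 < ENNReal.ofReal ε ^ 4 := by
    have := ENNReal.ofReal_pos.2 hε
    positivity
  have hx' : ⨅ N, ⨆ b, maxPS f N b x ^ 4 < ENNReal.ofReal ε ^ 4 := by
    have : (⨅ N, ⨆ b, maxPS f N b x ^ 4) = 0 := hx
    rw [this]; exact hpos
  obtain ⟨N, hN⟩ := iInf_lt_iff.1 hx'
  refine ⟨N, fun n hn => ?_⟩
  have h1 : maxPS f N n x ^ 4 < ENNReal.ofReal ε ^ 4 :=
    (le_iSup (fun b => maxPS f N b x ^ 4) n).trans_lt hN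
  have h2 : maxPS f N n x < ENNReal.ofReal ε := lt_of_not_ge fun hge =>
    absurd h1 (not_lt.2 (pow_le_pow_left₀ zero_le hge 4))
  have h3 : ‖∑ k ∈ Finset.Ico N n, f k x‖ₑ ≤ maxPS f N n x :=
    Finset.le_sup (f := fun j => ‖∑ k ∈ Finset.Ico N j, f k x‖ₑ)
      (Finset.mem_Icc.2 ⟨hn, le_rfl⟩)
  have h4 := h3.trans_lt h2
  rw [dist_eq_norm, ← Finset.sum_Ico_eq_sub _ hn]
  rw [← ofReal_norm] at h4
  exact (ENNReal.ofReal_lt_ofReal_iff hε).1 h4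

/-- **Corollary 2.** If `l ≥ 1` and `{m_k}` is an enumeration of `D*(l)`, then
`{e^{2πi m_k x}}` is an unconditional convergence system: if `∑ |c_k|² < ∞` then for every
permutation `σ` of the indices the series `∑_k c_{σ(k)} e^{2πi m_{σ(k)} x}` converges for
almost every `x ∈ (0,1)`. -/
theorem statement3 (l : ℕ) (hl : 1 ≤ l)
    (m : ℕ → ℕ) (hminj : Function.Injective m) (hmr : Set.range m = DyadicStar l)
    (c : ℕ → ℂ) (hc : Summable fun k => ‖c k‖ ^ 2) (σ : Equiv.Perm ℕ) :
    ∀ᵐ x ∂(volume.restrict (Set.Ioo (0:ℝ) 1)),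
      ∃ L : ℂ, Tendsto
        (fun N => ∑ k ∈ Finset.range N, c (σ k) * expi (m (σ k)) x) atTop (𝓝 L) := by
  have hinj : Function.Injective fun k => m (σ k) := hminj.comp σ.injective
  have hn : ∀ k, m (σ k) ∈ DyadicStar l := fun k => hmr ▸ Set.mem_range_self _
  have hs : Summable fun k => ‖c (σ k)‖ ^ 2 := hc.comp_injective σ.injective
  exact aux_conv _ (fun k x => c (σ k) * expi (m (σ k)) x)
    (fun k => (continuous_const.mul (expi_cont _)).measurable) _ (fun k => by positivity) hs
    (4 ^ (2 * l)) (by positivity)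
    (fun a b => aux_L4' l (fun k => m (σ k)) hinj hn (Finset.Ico a b) (fun k => c (σ k)))
end
end

section
/- Let l ≥ 2 be an integer, let {m_k} be an enumeration of the integers of D*(l), and let T = {t_{n,k}} be a summation method satisfying: for each n the family {t_{n,k} : k} has finitely many nonzero entries, |t_{n,k}| ≤ M for all n,k, and lim_{n→∞} t_{n,k} = 1 for each k. If real coefficients {a_k} are such that sup_n |∑_k t_{n,k} a_k w_{m_k}(x)| < ∞ for every x in a measurable set E ⊂ (0,1) of measure |E| > 1 − 2^{−4l}, then ∑_k a_k² < ∞. -/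
open MeasureTheory Filter Finset Topology

noncomputable section

/-- Rademacher function `r_n(x) = sign (sin (2^n π x))`. -/
def rademacher (n : ℕ) (x : ℝ) : ℝ := Real.sign (Real.sin (2 ^ n * Real.pi * x))

/-- Walsh function: for `m = 2^{k₁} + ⋯ + 2^{k_s}` (binary representation),
`w_m(x) = r_{k₁}(x) ⋯ r_{k_s}(x)`. -/
def walsh (m : ℕ) (x : ℝ) : ℝ :=
  ∏ k ∈ Finset.range (m + 1), if m.testBit k then rademacher k x else 1

/-- Bounded measurable functions. -/
def Nice (f : ℝ → ℝ) : Prop := Measurable f ∧ ∃ C, ∀ x, |f x| ≤ C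

lemma Nice.add {f g : ℝ → ℝ} (hf : Nice f) (hg : Nice g) : Nice (fun x => f x + g x) := by
  obtain ⟨h1, C, hC⟩ := hf
  obtain ⟨h2, D, hD⟩ := hg
  exact ⟨h1.add h2, C + D, fun x => (abs_add_le _ _).trans (add_le_add (hC x) (hD x))⟩

lemma Nice.mul {f g : ℝ → ℝ} (hf : Nice f) (hg : Nice g) : Nice (fun x => f x * g x) := by
  obtain ⟨h1, C, hC⟩ := hf
  obtain ⟨h2, D, hD⟩ := hg
  refine ⟨h1.mul h2, C * D, fun x => ?_⟩
  rw [abs_mul]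
  exact mul_le_mul (hC x) (hD x) (abs_nonneg _) ((abs_nonneg _).trans (hC x))

lemma Nice.const (c : ℝ) : Nice (fun _ => c) := ⟨measurable_const, |c|, fun _ => le_rfl⟩

lemma Nice.pow {f : ℝ → ℝ} (hf : Nice f) (n : ℕ) : Nice (fun x => f x ^ n) := by
  induction n with
  | zero => simpa using Nice.const 1
  | succ n ih => simpa [pow_succ] using ih.mul hf

lemma Nice.sum {ι : Type*} (I : Finset ι) {f : ι → ℝ → ℝ} (hf : ∀ i, Nice (f i)) :
    Nice (fun x => ∑ i ∈ I, f i x) := by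
  classical
  induction I using Finset.induction_on with
  | empty => simpa using Nice.const 0
  | insert a s ha ih => simpa [Finset.sum_insert ha] using (hf a).add ih

lemma Nice.prod {ι : Type*} (I : Finset ι) {f : ι → ℝ → ℝ} (hf : ∀ i, Nice (f i)) :
    Nice (fun x => ∏ i ∈ I, f i x) := by
  classical
  induction I using Finset.induction_on with
  | empty => simpa using Nice.const 1
  | insert a s ha ih => simpa [Finset.prod_insert ha] using (hf a).mul ih

lemma Nice.ii {f : ℝ → ℝ} (hf : Nice f) : IntervalIntegrable f volume 0 1 := by
  obtain ⟨h1, C, hC⟩ := hf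
  refine (intervalIntegrable_const (c := C)).mono_fun h1.aestronglyMeasurable ?_
  refine Eventually.of_forall fun x => ?_
  simp only [Real.norm_eq_abs]
  exact (hC x).trans (le_abs_self _)

lemma measurable_sgn : Measurable Real.sign := by
  unfold Real.sign
  exact Measurable.ite measurableSet_Iio measurable_const
    (Measurable.ite measurableSet_Ioi measurable_const measurable_const)

lemma nice_rad (n : ℕ) : Nice (rademacher n) := by
  constructor
  · unfold rademacher
    apply measurable_sgn.comp
    fun_prop
  · refine ⟨1, fun x => ?_⟩
    unfold rademacher
    rcases Real.sign_apply_eq (Real.sin (2 ^ n * Real.pi * x)) with h | h | h <;> simp [h]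

lemma rad_sq_ae (n : ℕ) : ∀ᵐ x : ℝ, rademacher n x ^ 2 = 1 := by
  have hc : (Set.range (fun z : ℤ => (z : ℝ) / 2 ^ n)).Countable := Set.countable_range _
  filter_upwards [hc.ae_notMem volume] with x hx
  have : Real.sin (2 ^ n * Real.pi * x) ≠ 0 := by
    intro h
    rw [Real.sin_eq_zero_iff] at h
    obtain ⟨z, hz⟩ := h
    apply hx
    refine ⟨z, ?_⟩
    have hp := Real.pi_ne_zero
    have : (z : ℝ) = 2 ^ n * x := by
      apply mul_right_cancel₀ hp
      rw [hz]; ring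
    simp only [this]
    field_simp
  unfold rademacher
  rcases Real.sign_apply_eq_of_ne_zero _ this with h | h <;> simp [h]

lemma rad_antiper (j : ℕ) (x : ℝ) : rademacher j (x + 1 / 2 ^ j) = - rademacher j x := by
  unfold rademacher
  have : (2 : ℝ) ^ j * Real.pi * (x + 1 / 2 ^ j) = 2 ^ j * Real.pi * x + Real.pi := by
    field_simp
  rw [this, Real.sin_add_pi, Real.sign_neg]

lemma rad_per {j k : ℕ} (h : j < k) : Function.Periodic (rademacher k) (1 / 2 ^ j) := by
  intro x
  obtain ⟨d, rfl⟩ := Nat.exists_eq_add_of_lt h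
  unfold rademacher
  have : (2 : ℝ) ^ (j + d + 1) * Real.pi * (x + 1 / 2 ^ j)
      = 2 ^ (j + d + 1) * Real.pi * x + ((2 ^ d : ℕ) : ℝ) * (2 * Real.pi) := by
    push_cast
    rw [pow_succ, pow_add]
    field_simp
  rw [this, Real.sin_add_nat_mul_two_pi]

/-- product of Rademacher functions -/
def wS (S : Finset ℕ) (x : ℝ) : ℝ := ∏ k ∈ S, rademacher k x

/-- Rademacher polynomial -/
def poly (I : Finset ℕ) (c : ℕ → ℝ) (S : ℕ → Finset ℕ) (x : ℝ) : ℝ := ∑ i ∈ I, c i * wS (S i) x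

lemma nice_poly (I c S) : Nice (poly I c S) :=
  Nice.sum I fun i => (Nice.const (c i)).mul (Nice.prod (S i) fun k => nice_rad k)

lemma poly_per {I c S} {j : ℕ} (h : ∀ i ∈ I, ∀ k ∈ S i, j < k) :
    Function.Periodic (poly I c S) (1 / 2 ^ j) := by
  intro x
  unfold poly wS
  refine Finset.sum_congr rfl fun i hi => ?_
  congr 1
  exact Finset.prod_congr rfl fun k hk => rad_per (h i hi k hk) x

lemma integral_anti {g : ℝ → ℝ} {c : ℝ} (h1 : Function.Periodic g 1) (h2 : ∀ x, g (x + c) = - g x) :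
    ∫ x in (0:ℝ)..1, g x = 0 := by
  have e1 := h1.intervalIntegral_add_eq 0 c
  have e2 : ∫ x in (0:ℝ)..1, g (x + c) = ∫ x in (0 + c)..(1 + c), g x :=
    intervalIntegral.integral_comp_add_right g c
  simp only [h2, intervalIntegral.integral_neg] at e2
  simp only [zero_add] at e1 e2
  rw [add_comm 1 c, ← e1] at e2
  linarith

lemma integral_rad_mul {j : ℕ} (hj : 1 ≤ j) {h : ℝ → ℝ} (hh : Function.Periodic h (1 / 2 ^ j)) :
    ∫ x in (0:ℝ)..1, rademacher j x * h x = 0 := by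
  apply integral_anti (c := 1 / 2 ^ j)
  · have a1 : Function.Periodic (rademacher j) 1 := by
      simpa using rad_per (j := 0) (k := j) (by omega)
    have a2 : Function.Periodic h 1 := by
      have := hh.nat_mul (2 ^ j)
      have e : ((2 ^ j : ℕ) : ℝ) * (1 / 2 ^ j) = 1 := by
        push_cast; field_simp
      rwa [e] at this
    exact a1.mul a2
  · intro x
    rw [rad_antiper, hh x]; ring

lemma int_sq_split {j : ℕ} (hj : 1 ≤ j) {Q R : ℝ → ℝ} (hQ : Nice Q) (hR : Nice R)
    (pQ : Function.Periodic Q (1 / 2 ^ j)) (pR : Function.Periodic R (1 / 2 ^ j)) :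
    ∫ x in (0:ℝ)..1, (Q x + rademacher j x * R x) ^ 2
      = (∫ x in (0:ℝ)..1, Q x ^ 2) + ∫ x in (0:ℝ)..1, R x ^ 2 := by
  have e : ∫ x in (0:ℝ)..1, (Q x + rademacher j x * R x) ^ 2
      = ∫ x in (0:ℝ)..1, ((Q x ^ 2 + R x ^ 2) + rademacher j x * (2 * (Q x * R x))) := by
    apply intervalIntegral.integral_congr_ae
    filter_upwards [rad_sq_ae j] with x hx _
    linear_combination R x ^ 2 * hx
  have z := integral_rad_mul hj (h := fun x => 2 * (Q x * R x)) (fun x => by simp only [pQ x, pR x])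
  rw [e, intervalIntegral.integral_add, z, add_zero, intervalIntegral.integral_add]
  · exact (hQ.pow 2).ii
  · exact (hR.pow 2).ii
  · exact ((hQ.pow 2).add (hR.pow 2)).ii
  · exact ((nice_rad j).mul ((Nice.const 2).mul (hQ.mul hR))).ii

lemma int_four_split {j : ℕ} (hj : 1 ≤ j) {Q R : ℝ → ℝ} (hQ : Nice Q) (hR : Nice R)
    (pQ : Function.Periodic Q (1 / 2 ^ j)) (pR : Function.Periodic R (1 / 2 ^ j)) :
    ∫ x in (0:ℝ)..1, (Q x + rademacher j x * R x) ^ 4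
      = (∫ x in (0:ℝ)..1, Q x ^ 4) + 6 * (∫ x in (0:ℝ)..1, Q x ^ 2 * R x ^ 2)
        + ∫ x in (0:ℝ)..1, R x ^ 4 := by
  have e : ∫ x in (0:ℝ)..1, (Q x + rademacher j x * R x) ^ 4
      = ∫ x in (0:ℝ)..1, ((Q x ^ 4 + 6 * (Q x ^ 2 * R x ^ 2) + R x ^ 4)
        + rademacher j x * (4 * (Q x ^ 3 * R x + Q x * R x ^ 3))) := by
    apply intervalIntegral.integral_congr_ae
    filter_upwards [rad_sq_ae j] with x hx _
    linear_combination (6 * Q x ^ 2 * R x ^ 2 + 4 * Q x * R x ^ 3 * rademacher j x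
      + R x ^ 4 * (rademacher j x ^ 2 + 1)) * hx
  have z := integral_rad_mul hj (h := fun x => 4 * (Q x ^ 3 * R x + Q x * R x ^ 3))
    (fun x => by simp only [pQ x, pR x])
  rw [e, intervalIntegral.integral_add, z, add_zero, intervalIntegral.integral_add,
    intervalIntegral.integral_add, intervalIntegral.integral_const_mul]
  · exact (hQ.pow 4).ii
  · exact ((Nice.const 6).mul ((hQ.pow 2).mul (hR.pow 2))).ii
  · exact ((hQ.pow 4).add ((Nice.const 6).mul ((hQ.pow 2).mul (hR.pow 2)))).ii
  · exact (hR.pow 4).ii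
  · exact (((hQ.pow 4).add ((Nice.const 6).mul ((hQ.pow 2).mul (hR.pow 2)))).add (hR.pow 4)).ii
  · exact ((nice_rad j).mul ((Nice.const 4).mul (((hQ.pow 3).mul hR).add (hQ.mul (hR.pow 3))))).ii

lemma int_nonneg {f : ℝ → ℝ} (h : ∀ x, 0 ≤ f x) : 0 ≤ ∫ x in (0:ℝ)..1, f x :=
  intervalIntegral.integral_nonneg (by norm_num) fun x _ => h x

lemma le_of_sq_le_sq₂ {a b : ℝ} (hb : 0 ≤ b) (h : a ^ 2 ≤ b ^ 2) : a ≤ b := (le_abs_self a).trans (abs_le_of_sq_le_sq h hb)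

lemma cauchy {f g : ℝ → ℝ} (hf : Nice f) (hg : Nice g) :
    (∫ x in (0:ℝ)..1, f x * g x) ^ 2
      ≤ (∫ x in (0:ℝ)..1, f x ^ 2) * ∫ x in (0:ℝ)..1, g x ^ 2 := by
  have key : ∀ s : ℝ, 0 ≤ (∫ x in (0:ℝ)..1, f x ^ 2) * (s * s)
      + (2 * ∫ x in (0:ℝ)..1, f x * g x) * s + ∫ x in (0:ℝ)..1, g x ^ 2 := by
    intro s
    have h0 : 0 ≤ ∫ x in (0:ℝ)..1, (s * f x + g x) ^ 2 := int_nonneg fun x => sq_nonneg _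
    have e : ∫ x in (0:ℝ)..1, (s * f x + g x) ^ 2
      = ∫ x in (0:ℝ)..1, ((s * s) * f x ^ 2 + (2 * s) * (f x * g x) + g x ^ 2) := by
      congr 1; ext x; ring
    rw [e, intervalIntegral.integral_add, intervalIntegral.integral_add,
      intervalIntegral.integral_const_mul, intervalIntegral.integral_const_mul] at h0
    · linarith
    · exact ((Nice.const _).mul (hf.pow 2)).ii
    · exact ((Nice.const _).mul (hf.mul hg)).ii
    · exact (((Nice.const _).mul (hf.pow 2)).add ((Nice.const _).mul (hf.mul hg))).ii
    · exact (hg.pow 2).ii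
  have := discrim_le_zero key
  unfold discrim at this
  linarith

lemma poly_split (I : Finset ℕ) (c : ℕ → ℝ) (S : ℕ → Finset ℕ) (j : ℕ) (x : ℝ) :
    poly I c S x = poly (I.filter fun i => j ∉ S i) c (fun i => (S i).erase j) x
      + rademacher j x * poly (I.filter fun i => j ∈ S i) c (fun i => (S i).erase j) x := by
  unfold poly
  rw [← Finset.sum_filter_not_add_sum_filter I (fun i => j ∈ S i), Finset.mul_sum]
  congr 1
  · refine Finset.sum_congr rfl fun i hi => ?_
    simp only [Finset.erase_eq_of_notMem (Finset.mem_filter.1 hi).2]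
  · refine Finset.sum_congr rfl fun i hi => ?_
    have : wS (S i) x = rademacher j x * wS ((S i).erase j) x :=
      (Finset.mul_prod_erase (S i) (fun k => rademacher k x) (Finset.mem_filter.1 hi).2).symm
    rw [this]; ring

lemma poly_const {I : Finset ℕ} {c : ℕ → ℝ} {S : ℕ → Finset ℕ} (h : ∀ i ∈ I, S i = ∅) (x : ℝ) :
    poly I c S x = ∑ i ∈ I, c i := by
  unfold poly
  refine Finset.sum_congr rfl fun i hi => ?_
  simp [h i hi, wS]

lemma erase_sub {T : Finset ℕ} {j d : ℕ} (h : T ⊆ Finset.Ico j (j + (d + 1))) :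
    T.erase j ⊆ Finset.Ico (j + 1) (j + 1 + d) := by
  intro k hk
  have := h (Finset.mem_of_mem_erase hk)
  have h2 := Finset.ne_of_mem_erase hk
  simp only [Finset.mem_Ico] at *
  omega

lemma bonami_const {I : Finset ℕ} {c : ℕ → ℝ} {S : ℕ → Finset ℕ} (l : ℕ) (h : ∀ i ∈ I, S i = ∅) :
    ∫ x in (0:ℝ)..1, poly I c S x ^ 4 ≤ 9 ^ l * (∫ x in (0:ℝ)..1, poly I c S x ^ 2) ^ 2 := by
  simp only [poly_const h]
  simp only [intervalIntegral.integral_const, sub_zero, one_smul]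
  have : (1:ℝ) ≤ 9 ^ l := one_le_pow₀ (by norm_num)
  have h4 : 0 ≤ (∑ i ∈ I, c i) ^ 4 := by positivity
  nlinarith

lemma bonami (d : ℕ) : ∀ (j : ℕ), 1 ≤ j → ∀ (l : ℕ) (I : Finset ℕ) (c : ℕ → ℝ) (S : ℕ → Finset ℕ),
    (∀ i ∈ I, S i ⊆ Finset.Ico j (j + d)) → (∀ i ∈ I, (S i).card ≤ l) →
    ∫ x in (0:ℝ)..1, poly I c S x ^ 4 ≤ 9 ^ l * (∫ x in (0:ℝ)..1, poly I c S x ^ 2) ^ 2 := by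
  induction d with
  | zero =>
    intro j hj l I c S h1 _
    refine bonami_const l fun i hi => ?_
    have := h1 i hi
    simpa using this
  | succ d ih =>
    intro j hj l I c S h1 h2
    cases l with
    | zero => exact bonami_const 0 fun i hi => by simpa using h2 i hi
    | succ l =>
      have hsub : ∀ i ∈ I, (S i).erase j ⊆ Finset.Ico (j + 1) (j + 1 + d) :=
        fun i hi => erase_sub (h1 i hi)
      have per : ∀ i ∈ I, ∀ k ∈ (S i).erase j, j < k := fun i hi k hk =>
        (Finset.mem_Ico.1 (hsub i hi hk)).1
      have iQ := ih (j + 1) (by omega) (l + 1) (I.filter fun i => j ∉ S i) c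
        (fun i => (S i).erase j) (fun i hi => hsub i (Finset.mem_filter.1 hi).1)
        (fun i hi => (Finset.card_erase_le).trans (h2 i (Finset.mem_filter.1 hi).1))
      have iR := ih (j + 1) (by omega) l (I.filter fun i => j ∈ S i) c
        (fun i => (S i).erase j) (fun i hi => hsub i (Finset.mem_filter.1 hi).1)
        (fun i hi => by
          have := h2 i (Finset.mem_filter.1 hi).1
          rw [Finset.card_erase_of_mem (Finset.mem_filter.1 hi).2]
          omega)
      have pQ := poly_per (I := I.filter fun i => j ∉ S i) (c := c) (S := fun i => (S i).erase j)
        (j := j) (fun i hi => per i (Finset.mem_filter.1 hi).1)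
      have pR := poly_per (I := I.filter fun i => j ∈ S i) (c := c) (S := fun i => (S i).erase j)
        (j := j) (fun i hi => per i (Finset.mem_filter.1 hi).1)
      simp only [poly_split I c S j]
      have nQ := nice_poly (I.filter fun i => j ∉ S i) c (fun i => (S i).erase j)
      have nR := nice_poly (I.filter fun i => j ∈ S i) c (fun i => (S i).erase j)
      rw [int_sq_split hj nQ nR pQ pR, int_four_split hj nQ nR pQ pR]
      have cs := cauchy (nQ.pow 2) (nR.pow 2)
      simp only [← pow_mul] at cs
      norm_num only at cs
      generalize poly (I.filter fun i => j ∉ S i) c (fun i => (S i).erase j) = Q at *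
      generalize poly (I.filter fun i => j ∈ S i) c (fun i => (S i).erase j) = R at *
      have a0 : 0 ≤ ∫ x in (0:ℝ)..1, Q x ^ 2 := int_nonneg fun x => by positivity
      have b0 : 0 ≤ ∫ x in (0:ℝ)..1, R x ^ 2 := int_nonneg fun x => by positivity
      have c0 : 0 ≤ ∫ x in (0:ℝ)..1, R x ^ 4 := int_nonneg fun x => by positivity
      generalize (∫ x in (0:ℝ)..1, Q x ^ 2) = A at *
      generalize (∫ x in (0:ℝ)..1, R x ^ 2) = B at *
      generalize (∫ x in (0:ℝ)..1, Q x ^ 4) = A4 at *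
      generalize (∫ x in (0:ℝ)..1, R x ^ 4) = B4 at *
      generalize (∫ x in (0:ℝ)..1, Q x ^ 2 * R x ^ 2) = Z at *
      have k0 : (0:ℝ) ≤ 9 ^ l := by positivity
      rw [pow_succ] at iQ ⊢
      generalize (9:ℝ) ^ l = K at *
      have hZ : Z ≤ 3 * K * A * B := by
        apply le_of_sq_le_sq₂ (by positivity)
        calc Z ^ 2 ≤ A4 * B4 := cs
          _ ≤ (K * 9 * A ^ 2) * (K * B ^ 2) := mul_le_mul iQ iR c0 (by positivity)
          _ = _ := by ring
      have : 0 ≤ K * B ^ 2 := by positivity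
      nlinarith

lemma parseval (d : ℕ) : ∀ (j : ℕ), 1 ≤ j → ∀ (I : Finset ℕ) (c : ℕ → ℝ) (S : ℕ → Finset ℕ),
    (∀ i ∈ I, S i ⊆ Finset.Ico j (j + d)) → Set.InjOn S I →
    ∫ x in (0:ℝ)..1, poly I c S x ^ 2 = ∑ i ∈ I, c i ^ 2 := by
  induction d with
  | zero =>
    intro j hj I c S h1 h2
    have h : ∀ i ∈ I, S i = ∅ := fun i hi => by simpa using h1 i hi
    simp only [poly_const h]
    simp only [intervalIntegral.integral_const, sub_zero, one_smul]
    have hc : I.card ≤ 1 := Finset.card_le_one.2 fun a ha b hb =>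
      h2 ha hb ((h a ha).trans (h b hb).symm)
    rcases Finset.card_le_one_iff_subset_singleton.1 hc with ⟨x, hx⟩
    rcases Finset.subset_singleton_iff.1 hx with rfl | rfl <;> simp
  | succ d ih =>
    intro j hj I c S h1 h2
    have hsub : ∀ i ∈ I, (S i).erase j ⊆ Finset.Ico (j + 1) (j + 1 + d) :=
      fun i hi => erase_sub (h1 i hi)
    have per : ∀ i ∈ I, ∀ k ∈ (S i).erase j, j < k := fun i hi k hk =>
      (Finset.mem_Ico.1 (hsub i hi hk)).1
    have iQ := ih (j + 1) (by omega) (I.filter fun i => j ∉ S i) c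
      (fun i => (S i).erase j) (fun i hi => hsub i (Finset.mem_filter.1 hi).1)
      (fun a ha b hb hab => by
        simp only [Finset.coe_filter, Set.mem_ofPred_eq] at ha hb
        simp only [Finset.erase_eq_of_notMem ha.2, Finset.erase_eq_of_notMem hb.2] at hab
        exact h2 ha.1 hb.1 hab)
    have iR := ih (j + 1) (by omega) (I.filter fun i => j ∈ S i) c
      (fun i => (S i).erase j) (fun i hi => hsub i (Finset.mem_filter.1 hi).1)
      (fun a ha b hb hab => by
        simp only [Finset.coe_filter, Set.mem_ofPred_eq] at ha hb
        apply h2 ha.1 hb.1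
        rw [← Finset.insert_erase ha.2, ← Finset.insert_erase hb.2]
        simp only at hab
        rw [hab])
    have pQ := poly_per (I := I.filter fun i => j ∉ S i) (c := c) (S := fun i => (S i).erase j)
      (j := j) (fun i hi => per i (Finset.mem_filter.1 hi).1)
    have pR := poly_per (I := I.filter fun i => j ∈ S i) (c := c) (S := fun i => (S i).erase j)
      (j := j) (fun i hi => per i (Finset.mem_filter.1 hi).1)
    simp only [poly_split I c S j]
    have nQ := nice_poly (I.filter fun i => j ∉ S i) c (fun i => (S i).erase j)
    have nR := nice_poly (I.filter fun i => j ∈ S i) c (fun i => (S i).erase j)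
    rw [int_sq_split hj nQ nR pQ pR, iQ, iR, Finset.sum_filter_not_add_sum_filter]

/-- the binary support of `m` -/
def bits (m : ℕ) : Finset ℕ := m.bitIndices.toFinset

lemma walsh_eq (m : ℕ) (x : ℝ) : walsh m x = wS (bits m) x := by
  unfold walsh wS
  rw [← Finset.prod_filter]
  refine Finset.prod_congr ?_ fun _ _ => rfl
  ext k
  simp only [bits, Finset.mem_filter, Finset.mem_range, List.mem_toFinset, Nat.mem_bitIndices]
  refine ⟨fun h => h.2, fun h => ⟨?_, h⟩⟩
  have h1 := Nat.two_pow_le_of_mem_bitIndices (Nat.mem_bitIndices.2 h)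
  have h2 := Nat.lt_two_pow_self (n := k)
  omega

lemma bits_inj : Function.Injective bits := Finset.equivBitIndices.injective

lemma bits_star {l m : ℕ} (h : m ∈ DyadicStar l) : (bits m).card ≤ l ∧ ∀ k ∈ bits m, 1 ≤ k := by
  simp only [DyadicStar, Set.mem_iUnion, DyadicSums] at h
  obtain ⟨s, hs, k, hk, hk1, rfl⟩ := h
  have e : bits (∑ j, 2 ^ k j) = Finset.univ.image k := by
    have : ∑ j, 2 ^ k j = ∑ i ∈ Finset.univ.image k, 2 ^ i := by
      rw [Finset.sum_image fun a _ b _ hab => hk.injective hab]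
    rw [bits, this, Finset.toFinset_bitIndices_sum_two_pow]
  rw [e]
  constructor
  · refine Finset.card_image_le.trans ?_
    simpa using hs.2
  · intro i hi
    simp only [Finset.mem_image, Finset.mem_univ, true_and] at hi
    obtain ⟨a, rfl⟩ := hi
    exact hk1 a

lemma main_bound {l : ℕ} (hl : 1 ≤ l) {P : ℝ → ℝ} (hP : Nice P)
    (h4 : ∫ x in (0:ℝ)..1, P x ^ 4 ≤ 9 ^ l * (∫ x in (0:ℝ)..1, P x ^ 2) ^ 2)
    {E : Set ℝ} (hE : MeasurableSet E) (hE1 : E ⊆ Set.Ioo 0 1)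
    (hEm : ENNReal.ofReal (1 - 1 / 2 ^ (4 * l)) < volume E) {B : ℝ}
    (hB : ∀ x ∈ E, |P x| ≤ B) : ∫ x in (0:ℝ)..1, P x ^ 2 ≤ 4 * B ^ 2 := by
  set u : ℝ → ℝ := E.indicator (fun _ => 1) with hu
  have nu : Nice u := by
    refine ⟨measurable_const.indicator hE, 1, fun x => ?_⟩
    by_cases hx : x ∈ E <;> simp [hu, hx]
  have nv : Nice (fun x => 1 + (-1) * u x) := (Nice.const 1).add ((Nice.const (-1)).mul nu)
  have hiu : ∫ x in (0:ℝ)..1, u x = volume.real E := by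
    rw [intervalIntegral.integral_of_le (by norm_num), hu, integral_indicator hE]
    simp only [integral_const, smul_eq_mul, mul_one]
    rw [measureReal_restrict_apply MeasurableSet.univ, Set.univ_inter]
    rw [measureReal_restrict_apply hE, Set.inter_eq_left.2 (hE1.trans Set.Ioo_subset_Ioc_self)]
  have hfin : volume E ≠ ⊤ :=
    ((measure_mono hE1).trans_lt (by simp : volume (Set.Ioo (0:ℝ) 1) < ⊤)).ne
  have hE2 : 1 - 1 / 2 ^ (4 * l) < volume.real E := by
    by_contra hcon
    push Not at hcon
    exact absurd hEm (not_lt.2 ((ENNReal.le_ofReal_iff_toReal_le hfin (by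
      exact (measureReal_nonneg).trans hcon)).2 hcon))
  have hv : ∫ x in (0:ℝ)..1, (1 + (-1) * u x) ^ 2 ≤ 1 / 2 ^ (4 * l) := by
    have : ∀ x, (1 + (-1) * u x) ^ 2 = 1 + (-1) * u x := by
      intro x
      by_cases hx : x ∈ E <;> simp [hu, hx]
    simp only [this]
    rw [intervalIntegral.integral_add (Nice.const 1).ii ((Nice.const (-1)).mul nu).ii,
      intervalIntegral.integral_const_mul, hiu]
    simp only [intervalIntegral.integral_const, sub_zero, one_smul]
    linarith
  have cs := cauchy nv (hP.pow 2)
  simp only [← pow_mul] at cs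
  norm_num only at cs
  have hsplit : ∫ x in (0:ℝ)..1, P x ^ 2 = (∫ x in (0:ℝ)..1, u x * P x ^ 2)
      + ∫ x in (0:ℝ)..1, (1 + (-1) * u x) * P x ^ 2 := by
    rw [← intervalIntegral.integral_add (nu.mul (hP.pow 2)).ii (nv.mul (hP.pow 2)).ii]
    congr 1; ext x; ring
  have hup : ∫ x in (0:ℝ)..1, u x * P x ^ 2 ≤ B ^ 2 := by
    have : ∫ x in (0:ℝ)..1, u x * P x ^ 2 ≤ ∫ x in (0:ℝ)..1, B ^ 2 := by
      apply intervalIntegral.integral_mono_on (by norm_num) (nu.mul (hP.pow 2)).ii (Nice.const _).ii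
      intro x _
      by_cases hx : x ∈ E
      · simp only [hu, hx, Set.indicator_of_mem, one_mul]
        rw [← sq_abs]
        exact pow_le_pow_left₀ (abs_nonneg _) (hB x hx) 2
      · simp [hu, hx]; positivity
    simpa using this
  have x0 : 0 ≤ ∫ x in (0:ℝ)..1, P x ^ 2 := int_nonneg fun x => by positivity
  have y0 : 0 ≤ ∫ x in (0:ℝ)..1, P x ^ 4 := int_nonneg fun x => by positivity
  have cs' : (∫ x in (0:ℝ)..1, (1 + (-1) * u x) * P x ^ 2) ^ 2
      ≤ (1 / 2 ^ (4 * l)) * (9 ^ l * (∫ x in (0:ℝ)..1, P x ^ 2) ^ 2) := by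
    refine le_trans (by simpa using cs) (mul_le_mul (by simpa using hv) h4 y0 (by positivity))
  generalize (∫ x in (0:ℝ)..1, (1 + (-1) * u x) * P x ^ 2) = Z at *
  generalize (∫ x in (0:ℝ)..1, P x ^ 2) = X at *
  have hZ : Z ≤ 3 / 4 * X := by
    apply le_of_sq_le_sq₂ (by positivity)
    refine cs'.trans ?_
    have e : (1 / 2 ^ (4 * l) : ℝ) * (9 ^ l * X ^ 2) = (9 / 16) ^ l * X ^ 2 := by
      rw [pow_mul, div_pow]; norm_num; ring
    rw [e]
    have : (9 / 16 : ℝ) ^ l ≤ (9 / 16) ^ 1 := pow_le_pow_of_le_one (by norm_num) (by norm_num) hl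
    nlinarith [sq_nonneg X]
  linarith

/-- **Theorem 4.** Let `l ≥ 2`, let `{m_k}` be an enumeration of `D*(l)` and let
`T = {t_{n,k}}` be a summation method (finite rows, uniformly bounded, `t_{n,k} → 1`).
If `sup_n |∑_k t_{n,k} a_k w_{m_k}(x)| < ∞` on a measurable set `E ⊆ (0,1)` of measure
`|E| > 1 - 2^{-4l}`, then `∑_k a_k² < ∞`. -/
theorem statement10 (l : ℕ) (hl : 2 ≤ l)
    (m : ℕ → ℕ) (hminj : Function.Injective m) (hmr : Set.range m = DyadicStar l)
    (t : ℕ → ℕ → ℝ) (M : ℝ)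
    (ht1 : ∀ i, (Function.support (t i)).Finite)
    (ht2 : ∀ i k, |t i k| ≤ M)
    (ht3 : ∀ k, Tendsto (fun i => t i k) atTop (𝓝 1))
    (a : ℕ → ℝ) (E : Set ℝ) (hE : MeasurableSet E) (hE1 : E ⊆ Set.Ioo 0 1)
    (hEm : ENNReal.ofReal (1 - 1 / 2 ^ (4 * l)) < volume E)
    (hb : ∀ x ∈ E, ∃ B : ℝ, ∀ i, |∑ᶠ k, t i k * a k * walsh (m k) x| ≤ B) :
    Summable (fun k => a k ^ 2) := by
  classical
  set S : ℕ → Finset ℕ := fun k => bits (m k) with hS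
  have hmem : ∀ k, m k ∈ DyadicStar l := fun k => hmr ▸ Set.mem_range_self k
  have hP : ∀ i x, ∑ᶠ k, t i k * a k * walsh (m k) x
      = poly (ht1 i).toFinset (fun k => t i k * a k) S x := by
    intro i x
    rw [finsum_eq_sum_of_support_subset (s := (ht1 i).toFinset)]
    · unfold poly
      simp only [walsh_eq, hS]
    · intro k hk
      simp only [Set.Finite.coe_toFinset, Function.mem_support] at *
      intro h0
      apply hk
      simp [h0]
  simp only [hP] at hb
  have hnice := fun i => nice_poly (ht1 i).toFinset (fun k => t i k * a k) S
  set P : ℕ → ℝ → ℝ := fun i => poly (ht1 i).toFinset (fun k => t i k * a k) S with hPdef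
  -- sets of uniform boundedness
  set F : ℕ → Set ℝ := fun N => E ∩ ⋂ i, {x | |P i x| ≤ N} with hF
  have hFm : ∀ N, MeasurableSet (F N) := fun N => hE.inter
    (MeasurableSet.iInter fun i => measurableSet_le (hnice i).1.abs measurable_const)
  have hFmono : Monotone F := by
    intro N N' h x hx
    refine ⟨hx.1, Set.mem_iInter.2 fun i => ?_⟩
    have := Set.mem_iInter.1 hx.2 i
    exact le_trans (show |P i x| ≤ N from this) (by exact_mod_cast h)
  have hFU : ⋃ N, F N = E := by
    ext x
    simp only [Set.mem_iUnion]
    refine ⟨fun ⟨N, h⟩ => h.1, fun hx => ?_⟩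
    obtain ⟨B, hB⟩ := hb x hx
    obtain ⟨N, hN⟩ := exists_nat_ge B
    exact ⟨N, hx, Set.mem_iInter.2 fun i => (hB i).trans hN⟩
  have hlim := tendsto_measure_iUnion_atTop (μ := volume) hFmono
  rw [hFU] at hlim
  obtain ⟨N, hN⟩ := (hlim.eventually (lt_mem_nhds hEm)).exists
  have key : ∀ i, ∑ k ∈ (ht1 i).toFinset, (t i k * a k) ^ 2 ≤ 4 * (N : ℝ) ^ 2 := by
    intro i
    have hsub : ∀ k ∈ (ht1 i).toFinset,
        S k ⊆ Finset.Ico 1 (1 + ((ht1 i).toFinset.sup m)) := by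
      intro k hk b hb'
      have h1 := (bits_star (hmem k)).2 b hb'
      have h2 := Nat.two_pow_le_of_mem_bitIndices (List.mem_toFinset.1 hb')
      have h3 := Nat.lt_two_pow_self (n := b)
      have h4 : m k ≤ _ := Finset.le_sup (f := m) hk
      simp only [Finset.mem_Ico]
      omega
    rw [← parseval _ 1 le_rfl _ (fun k => t i k * a k) S hsub
      ((bits_inj.comp hminj).injOn)]
    refine main_bound (by omega) (hnice i) ?_ (hFm N) (fun x hx => hE1 hx.1) hN ?_
    · exact bonami _ 1 le_rfl l _ _ S hsub fun k _ => (bits_star (hmem k)).1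
    · exact fun x hx => Set.mem_iInter.1 hx.2 i
  refine summable_of_sum_le (c := 4 * (N : ℝ) ^ 2) (fun k => sq_nonneg _) fun G => ?_
  have hG : Tendsto (fun i => ∑ k ∈ G, (t i k * a k) ^ 2) atTop (𝓝 (∑ k ∈ G, (1 * a k) ^ 2)) :=
    tendsto_finsetSum _ fun k _ => ((ht3 k).mul_const _).pow 2
  simp only [one_mul] at hG
  refine le_of_tendsto hG (Eventually.of_forall fun i => ?_)
  refine le_trans ?_ (key i)
  rw [Finset.sum_subset (Finset.subset_union_right (s₁ := G) (s₂ := (ht1 i).toFinset)) (f := fun k => (t i k * a k) ^ 2)]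
  · exact Finset.sum_le_sum_of_subset_of_nonneg Finset.subset_union_left
      fun k _ _ => sq_nonneg _
  · intro k _ hk
    have : t i k = 0 := by simpa using hk
    simp [this]
end
end
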